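/- arXiv:2406.05556 — 2 statements merged into one kernel-verified Lean document; each statement's English description precedes it below -/
import Mathlib

section
/- Let H be a separable real Hilbert space and let T : H → H be a positive self-adjoint compact operator whose eigenvalue-counting function satisfies M_T(γ) = κ₁ γ^{-β₁} + κ₂ γ^{-β₂} + o(γ^{-β₂}) as γ → 0, where κ₁ > 0, κ₂ ∈ ℝ, β₁, β₂ > 0, and either β₁/2 < β₂ < β₁, or β₁ = β₂ and κ₂ = 0. Then, with β* := β₁/(1+β₁-β₂), the entropy numbers of T satisfy ε_m(T) = (κ₁/(β₁ ln 2))^{1/β₁} m^{-1/β₁} + (κ₂/(κ₁ β₂)) (κ₁/(β₁ ln 2))^{1/β*} m^{-1/β*} + o(m^{-1/β*}) as m → ∞. -/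
open MeasureTheory Filter Asymptotics Topology TopologicalSpace
open scoped BigOperators ENNReal NNReal

noncomputable section

/-- The `ε`-covering number of a set `K` in a (pseudo)metric space: the minimal cardinality of a
finite set of points such that every point of `K` lies within distance `ε` of one of them. -/
def coveringNumber {X : Type*} [PseudoMetricSpace X] (ε : ℝ) (K : Set X) : ℕ :=
  sInf {n : ℕ | ∃ s : Finset X, s.card = n ∧ ∀ x ∈ K, ∃ y ∈ s, dist x y ≤ ε}

/-- The metric entropy `H(ε; K) = log₂ N(ε; K)`. -/
def metricEntropy {X : Type*} [PseudoMetricSpace X] (ε : ℝ) (K : Set X) : ℝ :=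
  Real.logb 2 (coveringNumber ε K)

/-- The entropy of a continuous linear operator: the metric entropy of the closure of the image
of the closed unit ball. -/
def opEntropy {H : Type*} [NormedAddCommGroup H] [InnerProductSpace ℝ H]
    (ε : ℝ) (T : H →L[ℝ] H) : ℝ :=
  metricEntropy ε (closure (T '' Metric.closedBall 0 1))

/-- The `m`-th entropy number of a continuous linear operator. -/
def opEntropyNumber {H : Type*} [NormedAddCommGroup H] [InnerProductSpace ℝ H]
    (m : ℕ) (T : H →L[ℝ] H) : ℝ :=
  sInf {ε : ℝ | 0 < ε ∧ opEntropy ε T ≤ m}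

open Metric Module in
open scoped Function in
/-- An `s`-separated finite subset of the ball of radius `r` has at most `(1 + 2 r / s) ^ dim`
points. -/
theorem card_le_of_separated_of_norm_le {E : Type*} [NormedAddCommGroup E] [NormedSpace ℝ E]
    [FiniteDimensional ℝ E] {r s : ℝ} (hr : 0 ≤ r) (hs : 0 < s) (S : Finset E)
    (hS : ∀ c ∈ S, ‖c‖ ≤ r) (hsep : ∀ c ∈ S, ∀ d ∈ S, c ≠ d → s < dist c d) :
    (S.card : ℝ) ≤ (1 + 2 * r / s) ^ finrank ℝ E := by
  borelize E
  let μ : Measure E := Measure.addHaar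
  have hdisj : Set.Pairwise (S : Set E) (Disjoint on fun c => ball (c : E) (s / 2)) := by
    rintro c hc d hd hcd
    apply ball_disjoint_ball
    have := hsep c hc d hd hcd
    linarith
  have hsub : (⋃ c ∈ S, ball (c : E) (s / 2)) ⊆ ball (0 : E) (r + s / 2) := by
    refine Set.iUnion₂_subset fun x hx => ?_
    apply ball_subset_ball'
    rw [dist_zero_right]
    linarith [hS x hx]
  have hle := measureReal_mono (μ := μ) hsub measure_ball_lt_top.ne
  rw [measureReal_biUnion_finset hdisj (fun c _ => measurableSet_ball)
    (fun c _ => measure_ball_lt_top.ne)] at hle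
  have hb : ∀ (x : E) (t : ℝ), 0 < t → μ.real (ball x t) = t ^ finrank ℝ E * μ.real (ball 0 1) := by
    intro x t ht
    rw [measureReal_def, μ.addHaar_ball_of_pos x ht, ENNReal.toReal_mul,
      ENNReal.toReal_ofReal (by positivity), ← measureReal_def]
  simp only [hb _ _ (half_pos hs), hb 0 (r + s / 2) (by positivity), Finset.sum_const,
    nsmul_eq_mul, ← mul_assoc] at hle
  have hpos : 0 < μ.real (ball (0 : E) 1) :=
    ENNReal.toReal_pos (measure_ball_pos μ _ one_pos).ne' measure_ball_lt_top.ne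
  have h2 := le_of_mul_le_mul_right hle hpos
  have : 1 + 2 * r / s = (r + s / 2) / (s / 2) := by field_simp; ring
  rw [this, div_pow, le_div_iff₀ (by positivity)]
  exact h2

open Metric Module in
/-- The ball of radius `r` has an `s`-net with at most `(1 + 2 r / s) ^ dim` points. -/
theorem exists_net_closedBall {E : Type*} [NormedAddCommGroup E] [NormedSpace ℝ E]
    [FiniteDimensional ℝ E] {r s : ℝ} (hr : 0 ≤ r) (hs : 0 < s) :
    ∃ S : Finset E, (∀ c ∈ S, ‖c‖ ≤ r) ∧ (S.card : ℝ) ≤ (1 + 2 * r / s) ^ finrank ℝ E ∧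
      ∀ x : E, ‖x‖ ≤ r → ∃ c ∈ S, dist x c ≤ s := by
  classical
  let A : Set ℕ := {n | ∃ S : Finset E, S.card = n ∧ (∀ c ∈ S, ‖c‖ ≤ r) ∧
    ∀ c ∈ S, ∀ d ∈ S, c ≠ d → s < dist c d}
  have hbdd : BddAbove A := by
    refine ⟨⌊(1 + 2 * r / s) ^ finrank ℝ E⌋₊, ?_⟩
    rintro n ⟨S, rfl, h1, h2⟩
    exact Nat.le_floor (card_le_of_separated_of_norm_le hr hs S h1 h2)
  obtain ⟨S, hcard, h1, h2⟩ := Nat.sSup_mem (s := A) ⟨0, ∅, by simp⟩ hbdd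
  refine ⟨S, h1, card_le_of_separated_of_norm_le hr hs S h1 h2, fun x hx => ?_⟩
  by_contra! hcon
  have hxS : x ∉ S := fun h => by
    have := hcon x h
    rw [dist_self] at this
    linarith
  have : S.card + 1 ∈ A := by
    refine ⟨insert x S, Finset.card_insert_of_notMem hxS, ?_, ?_⟩
    · intro c hc
      rcases Finset.mem_insert.1 hc with rfl | hc
      exacts [hx, h1 c hc]
    · intro c hc d hd hcd
      rcases Finset.mem_insert.1 hc with rfl | hc' <;>
        rcases Finset.mem_insert.1 hd with rfl | hd'
      · exact absurd rfl hcd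
      · exact hcon d hd'
      · rw [dist_comm]; exact hcon c hc'
      · exact h2 c hc' d hd' hcd
  have := le_csSup hbdd this
  omega

open Metric in
/-- Greedy covering: if every point of a finite set `S` is within `ρ` of a random point with
probability at least `p`, then few points suffice to cover `S`. -/
theorem exists_cover_finset_of_measure_closedBall_ge {X : Type*} [PseudoMetricSpace X]
    [MeasurableSpace X] [OpensMeasurableSpace X] (μ : Measure X) [IsProbabilityMeasure μ]
    (S : Finset X) {ρ p : ℝ} (hp : 0 < p) (hp1 : p ≤ 1)
    (hμ : ∀ x ∈ S, p ≤ μ.real (closedBall x ρ)) :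
    ∃ C : Finset X, (C.card : ℝ) ≤ Real.log S.card / p + 2 ∧
      ∀ x ∈ S, ∃ c ∈ C, dist x c ≤ ρ := by
  classical
  have step : ∀ U ⊆ S, ∃ c : X,
      (((U.filter fun x => ¬ dist x c ≤ ρ).card : ℕ) : ℝ) ≤ (1 - p) * U.card := by
    intro U hU
    let f : X → ℝ := fun c => ∑ x ∈ U, (closedBall x ρ).indicator (fun _ => (1 : ℝ)) c
    have hintegral : ∀ x ∈ U, Integrable ((closedBall x ρ).indicator (fun _ => (1 : ℝ))) μ :=
      fun x _ => (integrable_const _).indicator measurableSet_closedBall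
    obtain ⟨c, hc⟩ := exists_integral_le (μ := μ) (f := f) (integrable_finsetSum _ hintegral)
    refine ⟨c, ?_⟩
    have h1 : p * U.card ≤ ∫ a, f a ∂μ := by
      rw [integral_finsetSum _ hintegral]
      calc p * U.card = ∑ x ∈ U, p := by rw [Finset.sum_const, nsmul_eq_mul, mul_comm]
        _ ≤ _ := Finset.sum_le_sum fun x hx => by
          rw [integral_indicator_const _ measurableSet_closedBall, smul_eq_mul, mul_one]
          exact hμ x (hU hx)
    have h2 : f c = ((U.filter fun x => dist x c ≤ ρ).card : ℕ) := by
      simp only [f, Set.indicator_apply, mem_closedBall, Finset.sum_boole, dist_comm c]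
    have h3 := Finset.card_filter_add_card_filter_not (s := U) (fun x => dist x c ≤ ρ)
    have h4 : ((U.filter fun x => dist x c ≤ ρ).card : ℝ)
        + ((U.filter fun x => ¬ dist x c ≤ ρ).card : ℕ) = U.card := by exact_mod_cast h3
    linarith
  have iter : ∀ N : ℕ, ∃ C : Finset X, C.card ≤ N ∧
      (((S.filter fun x => ∀ c ∈ C, ¬ dist x c ≤ ρ).card : ℕ) : ℝ) ≤ (1 - p) ^ N * S.card := by
    intro N
    induction N with
    | zero => exact ⟨∅, by simp⟩
    | succ N ih =>
      obtain ⟨C, hC, hU⟩ := ih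
      obtain ⟨c, hc⟩ := step (S.filter fun x => ∀ c ∈ C, ¬ dist x c ≤ ρ) (Finset.filter_subset _ _)
      refine ⟨insert c C, (Finset.card_insert_le _ _).trans (by omega), ?_⟩
      have : (S.filter fun x => ∀ d ∈ insert c C, ¬ dist x d ≤ ρ)
          = (S.filter fun x => ∀ c ∈ C, ¬ dist x c ≤ ρ).filter fun x => ¬ dist x c ≤ ρ := by
        ext x; simp only [Finset.mem_filter, Finset.forall_mem_insert]; tauto
      rw [this]
      refine hc.trans ?_
      rw [pow_succ', mul_assoc]
      exact mul_le_mul_of_nonneg_left hU (by linarith)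
  rcases S.eq_empty_or_nonempty with rfl | hne
  · exact ⟨∅, by simp, by simp⟩
  have hS1 : (1 : ℝ) ≤ S.card := by exact_mod_cast hne.card_pos
  have hlog : 0 ≤ Real.log S.card := Real.log_nonneg hS1
  let N := ⌊Real.log S.card / p⌋₊ + 1
  have hN1 : Real.log S.card / p < N := by
    simpa [N] using Nat.lt_floor_add_one (Real.log S.card / p)
  have hN2 : (N : ℝ) ≤ Real.log S.card / p + 2 := by
    have := Nat.floor_le (div_nonneg hlog hp.le)
    simp only [N]; push_cast; linarith
  obtain ⟨C, hC, hU⟩ := iter N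
  refine ⟨C, le_trans (by exact_mod_cast hC) hN2, fun x hx => ?_⟩
  have hlt : (1 - p) ^ N * (S.card : ℝ) < 1 := by
    have e1 : (1 - p) ^ N ≤ Real.exp (-(p * N)) := by
      calc (1 - p) ^ N ≤ (Real.exp (-p)) ^ N :=
            pow_le_pow_left₀ (by linarith) (by linarith [Real.add_one_le_exp (-p)]) _
        _ = _ := by rw [← Real.exp_nat_mul]; ring_nf
    have e2 : Real.exp (-(p * N)) < (S.card : ℝ)⁻¹ := by
      rw [← Real.exp_log (show (0 : ℝ) < (S.card : ℝ)⁻¹ by positivity), Real.exp_lt_exp,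
        Real.log_inv]
      rw [div_lt_iff₀ hp] at hN1
      linarith
    calc _ < (S.card : ℝ)⁻¹ * S.card := by
          apply mul_lt_mul_of_pos_right (e1.trans_lt e2); linarith
      _ = 1 := inv_mul_cancel₀ (by linarith)
  have h0 : (S.filter fun x => ∀ c ∈ C, ¬ dist x c ≤ ρ).card = 0 := by
    have : (((S.filter fun x => ∀ c ∈ C, ¬ dist x c ≤ ρ).card : ℕ) : ℝ) < 1 := hU.trans_lt hlt
    have : (S.filter fun x => ∀ c ∈ C, ¬ dist x c ≤ ρ).card < 1 := by exact_mod_cast this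
    omega
  rw [Finset.card_eq_zero, Finset.filter_eq_empty_iff] at h0
  have := h0 hx
  push Not at this
  exact this

open Metric Module in
/-- A ball of radius `ρ` centred in the ball of radius `r` meets the ball of radius about
`√(r ^ 2 - ρ ^ 2)` in a set at least as large as a `1 / (2 dim)` fraction of the largest disc
inscribed in the intersection. -/
theorem measureReal_lens_ge {E : Type*} [NormedAddCommGroup E] [InnerProductSpace ℝ E]
    [FiniteDimensional ℝ E] [MeasurableSpace E] [BorelSpace E] (μ : Measure E)
    [μ.IsAddHaarMeasure] (hn : 0 < finrank ℝ E) {ρ r R : ℝ} (hρ : 0 < ρ) (hr : 0 < r)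
    (hR : 0 < R) (hRr : R ^ 2 + ρ ^ 2 = r ^ 2) {x : E} (hx : ‖x‖ ≤ r) :
    1 / (2 * (finrank ℝ E : ℝ)) * μ.real (closedBall 0 (R * ρ / r)) ≤
      μ.real (closedBall x ρ ∩ closedBall 0 (R * (1 + 1 / (finrank ℝ E : ℝ)))) := by
  have : Nontrivial E := finrank_pos_iff.1 hn
  set n : ℝ := (finrank ℝ E : ℝ) with hndef
  have hn1 : 1 ≤ n := by rw [hndef]; exact_mod_cast hn
  set h := R * ρ / r with hh
  have hhpos : 0 < h := by positivity
  have hhr : h ≤ r := by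
    rw [hh, div_le_iff₀ hr]; nlinarith [sq_nonneg (R - ρ)]
  obtain ⟨e, he1, hxe⟩ : ∃ e : E, ‖e‖ = 1 ∧ x = ‖x‖ • e := by
    by_cases hx0 : x = 0
    · obtain ⟨e, he⟩ := exists_norm_eq E zero_le_one
      exact ⟨e, he, by simp [hx0]⟩
    · have : ‖x‖ ≠ 0 := norm_ne_zero_iff.2 hx0
      exact ⟨‖x‖⁻¹ • x, by rw [norm_smul, norm_inv, norm_norm, inv_mul_cancel₀ this],
        by rw [smul_smul, mul_inv_cancel₀ this, one_smul]⟩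
  set t := ‖x‖ with ht
  have ht0 : 0 ≤ t := norm_nonneg x
  have hee : inner ℝ e e = 1 := by rw [real_inner_self_eq_norm_sq, he1, one_pow]
  set a := max (t - ρ ^ 2 / r) 0 with ha
  have ha0 : 0 ≤ a := le_max_right _ _
  have hRR : r - ρ ^ 2 / r = R ^ 2 / r := by field_simp; linarith
  have haR : a ≤ R ^ 2 / r := max_le (by linarith) (by positivity)
  have hta0 : 0 ≤ t - a := by
    have : 0 ≤ ρ ^ 2 / r := by positivity
    have : a ≤ t := max_le (by linarith) ht0
    linarith
  have hta : t - a ≤ ρ ^ 2 / r := by linarith [le_max_left (t - ρ ^ 2 / r) 0]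
  let Hf : Set E := {v | ‖v‖ ≤ h ∧ 0 ≤ inner ℝ e v}
  let f : E →ₗ[ℝ] E := LinearMap.transvection (innerₛₗ ℝ e) ((1 / n - 1) • e)
  have hdet : LinearMap.det f = 1 / n := by
    rw [LinearMap.transvection.det]
    simp [he1]
  have hsub : (fun u => u + a • e) '' (f '' Hf) ⊆
      closedBall x ρ ∩ closedBall 0 (R * (1 + 1 / n)) := by
    rintro _ ⟨_, ⟨v, ⟨hv1, hv2⟩, rfl⟩, rfl⟩
    set u := f v with hu
    set q : ℝ := inner ℝ e v with hq
    have huv : u = v + ((1 / n - 1) * q) • e := by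
      simp [hu, f, LinearMap.transvection.apply, hq, smul_smul, mul_comm]
    have hqh : q ≤ h := (real_inner_le_norm e v).trans (by rw [he1, one_mul]; exact hv1)
    have heu : inner ℝ e u = q / n := by
      rw [huv, inner_add_right, inner_smul_right, hee, ← hq]; ring
    have hn1' : 1 / n ≤ 1 := by rw [div_le_one (by linarith)]; exact hn1
    have hn0' : 0 ≤ 1 / n := by positivity
    have hun : ‖u‖ ^ 2 ≤ h ^ 2 := by
      have : ‖u‖ ^ 2 = ‖v‖ ^ 2 - (1 - (1 / n) ^ 2) * q ^ 2 := by
        rw [huv, norm_add_sq_real, inner_smul_right, real_inner_comm, ← hq, norm_smul, he1,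
          mul_one, Real.norm_eq_abs, sq_abs]; ring
      have h1 : ‖v‖ ^ 2 ≤ h ^ 2 := pow_le_pow_left₀ (norm_nonneg _) hv1 2
      have h2 : 0 ≤ (1 - (1 / n) ^ 2) * q ^ 2 :=
        mul_nonneg (by nlinarith) (sq_nonneg _)
      linarith
    have hh2 : h ^ 2 = R ^ 2 * ρ ^ 2 / r ^ 2 := by rw [hh]; ring
    constructor
    · rw [mem_closedBall, dist_comm, dist_eq_norm]
      have hxu : x - (u + a • e) = (t - a) • e - u := by
        conv_lhs => rw [hxe]
        module
      rw [hxu]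
      refine (sq_le_sq₀ (norm_nonneg _) hρ.le).1 ?_
      rw [norm_sub_sq_real, inner_smul_left, heu, norm_smul, he1, mul_one, Real.norm_eq_abs, sq_abs]
      have e1 : (t - a) ^ 2 ≤ (ρ ^ 2 / r) ^ 2 := pow_le_pow_left₀ hta0 hta 2
      have e2 : 0 ≤ (t - a) * (q / n) := mul_nonneg hta0 (by positivity)
      have e3 : (ρ ^ 2 / r) ^ 2 + R ^ 2 * ρ ^ 2 / r ^ 2 = ρ ^ 2 := by
        field_simp; rw [← hRr]; ring
      simp only [conj_trivial]
      linarith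
    · rw [mem_closedBall, dist_zero_right]
      refine (sq_le_sq₀ (norm_nonneg _) (by positivity)).1 ?_
      rw [norm_add_sq_real, inner_smul_right, real_inner_comm, heu, norm_smul, he1, mul_one,
        Real.norm_eq_abs, sq_abs]
      have e1 : a ^ 2 ≤ (R ^ 2 / r) ^ 2 := pow_le_pow_left₀ ha0 haR 2
      have e2 : a * (q / n) ≤ R ^ 2 / n := by
        calc a * (q / n) ≤ (R ^ 2 / r) * (r / n) := by
              gcongr; exact hqh.trans hhr
          _ = R ^ 2 / n := by field_simp
      have e3 : (R ^ 2 / r) ^ 2 + R ^ 2 * ρ ^ 2 / r ^ 2 = R ^ 2 := by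
        field_simp; rw [← hRr]
      have e4 : (R * (1 + 1 / n)) ^ 2 = R ^ 2 + 2 * (R ^ 2 / n) + (R / n) ^ 2 := by
        field_simp; ring
      rw [e4]
      nlinarith [sq_nonneg (R / n)]
  have hHf : μ.real (closedBall 0 h) ≤ 2 * μ.real Hf := by
    have hc : closedBall (0 : E) h ⊆ Hf ∪ -Hf := by
      intro v hv
      rw [mem_closedBall, dist_zero_right] at hv
      rcases le_total 0 (inner ℝ e v : ℝ) with h0 | h0
      · exact Or.inl ⟨hv, h0⟩
      · exact Or.inr ⟨by rwa [norm_neg], by rw [inner_neg_right]; linarith⟩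
    have hfin : μ Hf ≠ ⊤ := measure_ne_top_of_subset
      (fun v hv => by rw [mem_closedBall, dist_zero_right]; exact hv.1)
      (measure_closedBall_lt_top (x := (0 : E)) (r := h)).ne
    have hneg : μ (-Hf) = μ Hf := Measure.measure_neg μ Hf
    calc μ.real (closedBall 0 h) ≤ μ.real (Hf ∪ -Hf) :=
          measureReal_mono hc (measure_union_ne_top hfin (hneg ▸ hfin))
      _ ≤ μ.real Hf + μ.real (-Hf) := measureReal_union_le _ _
      _ = 2 * μ.real Hf := by rw [measureReal_def, measureReal_def, hneg]; ring
  have him : μ.real ((fun u => u + a • e) '' (f '' Hf)) = 1 / n * μ.real Hf := by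
    rw [measureReal_def, Set.image_add_right, measure_preimage_add_right,
      Measure.addHaar_image_linearMap, hdet, ENNReal.toReal_mul, ENNReal.toReal_ofReal (abs_nonneg _),
      abs_of_nonneg (by positivity), ← measureReal_def]
  have hle := measureReal_mono (μ := μ) hsub
    (measure_ne_top_of_subset Set.inter_subset_left measure_closedBall_lt_top.ne)
  rw [him] at hle
  refine le_trans ?_ hle
  calc 1 / (2 * n) * μ.real (closedBall 0 h) ≤ 1 / (2 * n) * (2 * μ.real Hf) := by gcongr
    _ = _ := by field_simp

open Metric Module in
/-- A ball of radius `r` can be covered by `(r / ρ) ^ n` balls of radius `(1 + η) ρ`, up to a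
factor polynomial in the dimension `n`. -/
theorem exists_cover_closedBall_card_le {E : Type*} [NormedAddCommGroup E] [InnerProductSpace ℝ E]
    [FiniteDimensional ℝ E] {ρ r η : ℝ} (hρ : 0 < ρ) (hρr : ρ ≤ r) (hη : 0 < η) (hη1 : η ≤ 1) :
    ∃ C : Finset E, (C.card : ℝ) ≤ (r / ρ) ^ finrank ℝ E *
        (2 * Real.exp 1 * finrank ℝ E * (finrank ℝ E * Real.log (3 * r / (η * ρ))) + 2) ∧
      ∀ x : E, ‖x‖ ≤ r → ∃ c ∈ C, dist x c ≤ (1 + η) * ρ := by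
  have hr : 0 < r := hρ.trans_le hρr
  have hrρ : 1 ≤ r / ρ := (one_le_div hρ).2 hρr
  have hq : 1 ≤ r / (η * ρ) := (one_le_div (by positivity)).2 (by nlinarith)
  have hq3 : 1 ≤ 3 * r / (η * ρ) := by rw [mul_div_assoc]; linarith
  have hlog : 0 ≤ Real.log (3 * r / (η * ρ)) := Real.log_nonneg hq3
  have hpow : 1 ≤ (r / ρ) ^ finrank ℝ E := one_le_pow₀ hrρ
  have htriv : (∀ x : E, ‖x‖ ≤ r → ‖x‖ ≤ ρ) → ∃ C : Finset E, (C.card : ℝ) ≤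
      (r / ρ) ^ finrank ℝ E *
        (2 * Real.exp 1 * finrank ℝ E * (finrank ℝ E * Real.log (3 * r / (η * ρ))) + 2) ∧
      ∀ x : E, ‖x‖ ≤ r → ∃ c ∈ C, dist x c ≤ (1 + η) * ρ := by
    intro hall
    refine ⟨{0}, ?_, fun x hx => ⟨0, Finset.mem_singleton_self _, ?_⟩⟩
    · have : 0 ≤ 2 * Real.exp 1 * finrank ℝ E * (finrank ℝ E * Real.log (3 * r / (η * ρ))) := by
        positivity
      rw [Finset.card_singleton, Nat.cast_one]
      nlinarith
    · rw [dist_zero_right]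
      nlinarith [hall x hx]
  rcases Nat.eq_zero_or_pos (finrank ℝ E) with h0 | hn
  · have : Subsingleton E := finrank_zero_iff.1 h0
    exact htriv fun x _ => by rw [Subsingleton.elim x 0, norm_zero]; exact hρ.le
  rcases hρr.eq_or_lt with rfl | hlt
  · exact htriv fun x hx => hx
  borelize E
  let μ : Measure E := Measure.addHaar
  set n := finrank ℝ E with hndef
  have hn0 : (0 : ℝ) < n := by exact_mod_cast hn
  set R := √(r ^ 2 - ρ ^ 2) with hRdef
  have hpos : 0 < r ^ 2 - ρ ^ 2 := by nlinarith
  have hR : 0 < R := Real.sqrt_pos.2 hpos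
  have hR2 : R ^ 2 + ρ ^ 2 = r ^ 2 := by rw [hRdef, Real.sq_sqrt hpos.le]; ring
  set R' := R * (1 + 1 / (n : ℝ)) with hR'
  have hR'pos : 0 < R' := by positivity
  set B := closedBall (0 : E) R' with hB
  have hBpos : 0 < μ B := measure_closedBall_pos μ _ hR'pos
  have hBtop : μ B ≠ ⊤ := measure_closedBall_lt_top.ne
  have : IsProbabilityMeasure (ProbabilityTheory.cond μ B) :=
    ProbabilityTheory.cond_isProbabilityMeasure_of_finite hBpos.ne' hBtop
  set p : ℝ := (ρ / r) ^ n / (2 * Real.exp 1 * n) with hp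
  have hppos : 0 < p := by positivity
  have hpμ : ∀ x : E, ‖x‖ ≤ r → p ≤ (ProbabilityTheory.cond μ B).real (closedBall x ρ) := by
    intro x hx
    have h1 := measureReal_lens_ge μ hn hρ hr hR hR2 hx
    rw [measureReal_def, ProbabilityTheory.cond_apply measurableSet_closedBall, ENNReal.toReal_mul,
      ENNReal.toReal_inv, ← measureReal_def, ← measureReal_def, Set.inter_comm]
    have hBr : μ.real B = R' ^ n * μ.real (closedBall 0 1) :=
      Measure.addHaar_real_closedBall' μ 0 hR'pos.le
    have hhr : μ.real (closedBall (0 : E) (R * ρ / r))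
        = (R * ρ / r) ^ n * μ.real (closedBall 0 1) :=
      Measure.addHaar_real_closedBall' μ 0 (by positivity)
    have hω : 0 < μ.real (closedBall (0 : E) 1) :=
      ENNReal.toReal_pos (measure_closedBall_pos μ _ one_pos).ne' measure_closedBall_lt_top.ne
    have hBrpos : 0 < μ.real B := by rw [hBr]; positivity
    rw [inv_mul_eq_div, le_div_iff₀ hBrpos]
    refine le_trans ?_ h1
    rw [hBr, hhr, hp, hR']
    have he : (1 + 1 / (n : ℝ)) ^ n ≤ Real.exp 1 := by
      calc (1 + 1 / (n : ℝ)) ^ n ≤ (Real.exp (1 / n)) ^ n :=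
            pow_le_pow_left₀ (by positivity) (by linarith [Real.add_one_le_exp (1 / (n : ℝ))]) _
        _ = Real.exp 1 := by
            rw [← Real.exp_nat_mul, mul_one_div_cancel hn0.ne']
    calc (ρ / r) ^ n / (2 * Real.exp 1 * n) * ((R * (1 + 1 / (n : ℝ))) ^ n
            * μ.real (closedBall 0 1))
        = (1 / (2 * (n : ℝ)) * ((R * ρ / r) ^ n * μ.real (closedBall (0 : E) 1)))
            * ((1 + 1 / (n : ℝ)) ^ n / Real.exp 1) := by
          rw [mul_pow, show R * ρ / r = R * (ρ / r) by ring, mul_pow R (ρ / r)]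
          field_simp
      _ ≤ (1 / (2 * (n : ℝ)) * ((R * ρ / r) ^ n * μ.real (closedBall (0 : E) 1))) * 1 := by
          gcongr
          rw [div_le_one (Real.exp_pos _)]
          exact he
      _ = _ := mul_one _
  have hp1 : p ≤ 1 := (hpμ 0 (by simpa using hr.le)).trans measureReal_le_one
  obtain ⟨S, hS1, hS2, hS3⟩ := exists_net_closedBall (E := E) hr.le (mul_pos hη hρ)
  obtain ⟨C, hC1, hC2⟩ := exists_cover_finset_of_measure_closedBall_ge
    (ProbabilityTheory.cond μ B) S (ρ := ρ) hppos hp1 (fun x hx => hpμ x (hS1 x hx))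
  refine ⟨C, hC1.trans ?_, fun x hx => ?_⟩
  · have hSne : 0 < S.card := by
      obtain ⟨c, hc, _⟩ := hS3 0 (by simpa using hr.le)
      exact Finset.card_pos.2 ⟨c, hc⟩
    have hlogS : Real.log S.card ≤ n * Real.log (3 * r / (η * ρ)) := by
      rw [← Real.log_pow]
      refine Real.log_le_log (by exact_mod_cast hSne) (hS2.trans ?_)
      refine pow_le_pow_left₀ (by positivity) ?_ _
      rw [mul_div_assoc, mul_div_assoc]
      linarith
    have hpinv : 1 / p = (r / ρ) ^ n * (2 * Real.exp 1 * n) := by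
      rw [hp, one_div_div, div_pow, div_pow]; field_simp
    calc Real.log S.card / p + 2 ≤ (n * Real.log (3 * r / (η * ρ))) / p + 2 := by gcongr
      _ = (r / ρ) ^ n * (2 * Real.exp 1 * n * (n * Real.log (3 * r / (η * ρ)))) + 2 := by
          rw [div_eq_mul_one_div, hpinv]; ring
      _ ≤ _ := by rw [mul_add]; linarith
  · obtain ⟨y, hy, hxy⟩ := hS3 x hx
    obtain ⟨c, hc, hyc⟩ := hC2 y hy
    exact ⟨c, hc, (dist_triangle x y c).trans (by linarith)⟩

/-- Reverse water-filling: the distortion budget `ε ^ 2 * ∑ w` can be split among blocks of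
dimensions `k j` and squared radii `w j * l j ^ 2` at a rate independent of the weights `w`. -/
theorem exists_distortion_allocation {ι : Type*} [Fintype ι] (k w l : ι → ℝ) {ε : ℝ}
    (hε : 0 < ε) (hk : ∀ j, 0 < k j) (hw : ∀ j, 0 < w j) (hl : ∀ j, ε ≤ l j) :
    ∃ D : ι → ℝ, (∀ j, 0 < D j) ∧ (∀ j, D j ≤ w j * l j ^ 2) ∧
      ∑ j, D j = ε ^ 2 * ∑ j, w j ∧
      ∑ j, k j * Real.log (w j * l j ^ 2 / D j) ≤ ∑ j, k j * Real.log (l j ^ 2 / ε ^ 2) := by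
  rcases isEmpty_or_nonempty ι with hι | hι
  · exact ⟨fun _ => 1, by simp⟩
  have hl0 : ∀ j, 0 < l j := fun j => hε.trans_le (hl j)
  have hsq : ∀ j, ε ^ 2 ≤ l j ^ 2 := fun j => pow_le_pow_left₀ hε.le (hl j) 2
  let g : ℝ → ℝ := fun θ => ∑ j, min (w j * l j ^ 2) (k j * θ)
  have hg : Continuous g := by fun_prop
  let Θ := ∑ j, w j * l j ^ 2 / k j
  have hterm : ∀ j, 0 < w j * l j ^ 2 / k j := fun j => by
    have := hk j; have := hw j; have := hl0 j; positivity
  have hΘ : 0 ≤ Θ := Finset.sum_nonneg fun j _ => (hterm j).le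
  have hgΘ : ε ^ 2 * ∑ j, w j ≤ g Θ := by
    rw [Finset.mul_sum]
    refine Finset.sum_le_sum fun j _ => le_min ?_ ?_
    · rw [mul_comm]; exact mul_le_mul_of_nonneg_left (hsq j) (hw j).le
    · have h1 : w j * l j ^ 2 / k j ≤ Θ :=
        Finset.single_le_sum (f := fun j => w j * l j ^ 2 / k j)
          (fun i _ => (hterm i).le) (Finset.mem_univ j)
      rw [div_le_iff₀ (hk j)] at h1
      nlinarith [mul_le_mul_of_nonneg_left (hsq j) (hw j).le]
  have hsum : 0 < ∑ j, w j := Finset.sum_pos (fun j _ => hw j) Finset.univ_nonempty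
  have hg0 : g 0 = 0 := by
    refine Finset.sum_eq_zero fun j _ => ?_
    rw [mul_zero]
    exact min_eq_right (mul_nonneg (hw j).le (sq_nonneg _))
  obtain ⟨θ, ⟨hθ0, -⟩, hθ⟩ := intermediate_value_Icc hΘ hg.continuousOn
    (show ε ^ 2 * ∑ j, w j ∈ Set.Icc (g 0) (g Θ) from ⟨by rw [hg0]; positivity, hgΘ⟩)
  have hθpos : 0 < θ := by
    rcases hθ0.eq_or_lt with rfl | h
    · rw [hg0] at hθ
      have : 0 < ε ^ 2 * ∑ j, w j := by positivity
      linarith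
    · exact h
  refine ⟨fun j => min (w j * l j ^ 2) (k j * θ), fun j => lt_min ?_ ?_,
    fun j => min_le_left _ _, hθ, ?_⟩
  · have := hw j; have := hl0 j; positivity
  · exact mul_pos (hk j) hθpos
  have key : ∀ j, k j * Real.log (w j * l j ^ 2 / min (w j * l j ^ 2) (k j * θ))
      + (min (w j * l j ^ 2) (k j * θ) - w j * ε ^ 2) / θ ≤ k j * Real.log (l j ^ 2 / ε ^ 2) := by
    intro j
    have hkj := hk j
    have hwj := hw j
    have hlj := hl0 j
    rcases le_total (w j * l j ^ 2) (k j * θ) with h | h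
    · rw [min_eq_left h, div_self (by positivity), Real.log_one, mul_zero, zero_add]
      have h1 : 1 - ε ^ 2 / l j ^ 2 ≤ Real.log (l j ^ 2 / ε ^ 2) := by
        have := Real.one_sub_inv_le_log_of_pos (show 0 < l j ^ 2 / ε ^ 2 by positivity)
        rwa [inv_div] at this
      have h2 : (w j * l j ^ 2 - w j * ε ^ 2) / θ ≤ k j * (1 - ε ^ 2 / l j ^ 2) := by
        rw [div_le_iff₀ hθpos]
        have h3 : 0 ≤ 1 - ε ^ 2 / l j ^ 2 := by
          rw [sub_nonneg, div_le_one (by positivity)]; exact hsq j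
        have h4 : w j * l j ^ 2 - w j * ε ^ 2 = (w j * l j ^ 2) * (1 - ε ^ 2 / l j ^ 2) := by
          field_simp
        rw [h4]
        nlinarith [mul_le_mul_of_nonneg_right h h3]
      exact h2.trans (mul_le_mul_of_nonneg_left h1 hkj.le)
    · rw [min_eq_right h]
      have hy : 0 < w j * ε ^ 2 / (k j * θ) := by positivity
      have h1 := Real.log_le_sub_one_of_pos hy
      have h2 : w j * l j ^ 2 / (k j * θ) = (l j ^ 2 / ε ^ 2) * (w j * ε ^ 2 / (k j * θ)) := by
        field_simp
      rw [h2, Real.log_mul (by positivity) hy.ne']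
      have h3 : (k j * θ - w j * ε ^ 2) / θ = k j * (1 - w j * ε ^ 2 / (k j * θ)) := by
        field_simp
      rw [h3]
      nlinarith [mul_le_mul_of_nonneg_left h1 hkj.le]
  have hs := Finset.sum_le_sum fun j (_ : j ∈ Finset.univ) => key j
  have h0 : ∑ j, (min (w j * l j ^ 2) (k j * θ) - w j * ε ^ 2) / θ = 0 := by
    rw [← Finset.sum_div, Finset.sum_sub_distrib, ← Finset.sum_mul]
    have : (∑ j, min (w j * l j ^ 2) (k j * θ)) = ε ^ 2 * ∑ j, w j := hθ
    rw [this]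
    ring
  rw [Finset.sum_add_distrib, h0, add_zero] at hs
  exact hs

/-- The block ellipsoid `∑ j, ‖v j‖ ^ 2 / l j ^ 2 ≤ 1` admits a cover of logarithmic size
`∑ j, k j * log (l j / ε)`, up to lower order terms. -/
theorem exists_cover_block_ellipsoid {ι : Type*} [Fintype ι] [DecidableEq ι] {κ : ι → Type*}
    [∀ j, Fintype (κ j)] [∀ j, Nonempty (κ j)] (l : ι → ℝ) {ε η : ℝ} (hε : 0 < ε) (hη : 0 < η)
    (hη1 : η ≤ 1) (hl : ∀ j, ε ≤ l j) (L : ℕ) (hL : 0 < L) (S K : ℝ)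
    (hS : ∑ j, (Fintype.card (κ j) : ℝ) * Real.log (l j / ε) ≤ S)
    (hK : ∀ j, (Fintype.card (κ j) : ℝ) ≤ K) :
    ∃ C : Finset (∀ j, EuclideanSpace ℝ (κ j)),
      (C.card : ℝ) ≤ Real.exp S *
        ((L + 1) * (2 * Real.exp 1 * K * (K * Real.log (3 / η) + S) + 2)) ^ Fintype.card ι ∧
      ∀ v : (∀ j, EuclideanSpace ℝ (κ j)), ∑ j, ‖v j‖ ^ 2 / l j ^ 2 ≤ 1 →
        ∃ c ∈ C, ∑ j, dist (v j) (c j) ^ 2 ≤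
          (1 + η) ^ 2 * ε ^ 2 * (∑ j, ‖v j‖ ^ 2 / l j ^ 2 + Fintype.card ι / L) := by
  classical
  have hL0 : (0 : ℝ) < L := by exact_mod_cast hL
  have hl0 : ∀ j, 0 < l j := fun j => hε.trans_le (hl j)
  have hk0 : ∀ j, (0 : ℝ) < Fintype.card (κ j) := fun j => by exact_mod_cast Fintype.card_pos
  have hlog3 : 0 ≤ Real.log (3 / η) := Real.log_nonneg (by rw [one_le_div hη]; linarith)
  set P : ℝ := 2 * Real.exp 1 * K * (K * Real.log (3 / η) + S) + 2 with hP
  let w : (ι → Fin (L + 1)) → ι → ℝ := fun τ j => ((τ j : ℕ) + 1) / L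
  have hw : ∀ τ j, 0 < w τ j := fun τ j => by positivity
  choose D hD0 hDle hDsum hDlog using fun τ =>
    exists_distortion_allocation (fun j => (Fintype.card (κ j) : ℝ)) (w τ) l hε hk0 (hw τ) hl
  have hr0 : ∀ τ j, 0 < √(w τ j) * l j := fun τ j => mul_pos (Real.sqrt_pos.2 (hw τ j)) (hl0 j)
  have hρ0 : ∀ τ j, 0 < √(D τ j) := fun τ j => Real.sqrt_pos.2 (hD0 τ j)
  have hρr : ∀ τ j, √(D τ j) ≤ √(w τ j) * l j := fun τ j => by
    rw [← Real.sqrt_sq (hl0 j).le, ← Real.sqrt_mul (hw τ j).le]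
    exact Real.sqrt_le_sqrt (hDle τ j)
  choose Cb hCcard hCcov using fun τ j =>
    exists_cover_closedBall_card_le (E := EuclideanSpace ℝ (κ j)) (hρ0 τ j) (hρr τ j) hη hη1
  have hlogrρ : ∀ τ j, Real.log (√(w τ j) * l j / √(D τ j))
      = Real.log (w τ j * l j ^ 2 / D τ j) / 2 := fun τ j => by
    rw [← Real.log_sqrt (by have := hw τ j; have := hD0 τ j; positivity),
      Real.sqrt_div' _ (hD0 τ j).le,
      Real.sqrt_mul (hw τ j).le, Real.sqrt_sq (hl0 j).le]
  have hrate : ∀ τ, ∑ j, (Fintype.card (κ j) : ℝ) * Real.log (√(w τ j) * l j / √(D τ j)) ≤ S := by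
    intro τ
    have h1 := hDlog τ
    have h2 : ∀ j, Real.log (l j ^ 2 / ε ^ 2) = 2 * Real.log (l j / ε) := fun j => by
      rw [← div_pow, Real.log_pow]; norm_num
    simp only [h2] at h1
    simp only [hlogrρ]
    have h3 : ∑ j, (Fintype.card (κ j) : ℝ) * (2 * Real.log (l j / ε))
        = 2 * ∑ j, (Fintype.card (κ j) : ℝ) * Real.log (l j / ε) := by
      rw [Finset.mul_sum]; exact Finset.sum_congr rfl fun j _ => by ring
    have h4 : ∑ j, (Fintype.card (κ j) : ℝ) * (Real.log (w τ j * l j ^ 2 / D τ j) / 2)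
        = (∑ j, (Fintype.card (κ j) : ℝ) * Real.log (w τ j * l j ^ 2 / D τ j)) / 2 := by
      rw [Finset.sum_div]; exact Finset.sum_congr rfl fun j _ => by ring
    rw [h4]
    linarith
  have hterm0 : ∀ τ j, 0 ≤ (Fintype.card (κ j) : ℝ) * Real.log (√(w τ j) * l j / √(D τ j)) :=
    fun τ j => mul_nonneg (hk0 j).le (Real.log_nonneg ((one_le_div (hρ0 τ j)).2 (hρr τ j)))
  have hCP : ∀ τ j, ((Cb τ j).card : ℝ) ≤
      Real.exp ((Fintype.card (κ j) : ℝ) * Real.log (√(w τ j) * l j / √(D τ j))) * P := by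
    intro τ j
    refine (hCcard τ j).trans ?_
    rw [finrank_euclideanSpace]
    have hq : 0 < √(w τ j) * l j / √(D τ j) := div_pos (hr0 τ j) (hρ0 τ j)
    have h1 : (√(w τ j) * l j / √(D τ j)) ^ Fintype.card (κ j) =
        Real.exp ((Fintype.card (κ j) : ℝ) * Real.log (√(w τ j) * l j / √(D τ j))) := by
      rw [Real.exp_nat_mul, Real.exp_log hq]
    rw [h1]
    refine mul_le_mul_of_nonneg_left ?_ (Real.exp_pos _).le
    have h2 : Real.log (3 * (√(w τ j) * l j) / (η * √(D τ j)))
        = Real.log (3 / η) + Real.log (√(w τ j) * l j / √(D τ j)) := by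
      rw [← Real.log_mul (by positivity) hq.ne']
      congr 1
      have := hρ0 τ j
      field_simp
    have h3 : (Fintype.card (κ j) : ℝ) * Real.log (√(w τ j) * l j / √(D τ j)) ≤ S :=
      (Finset.single_le_sum (f := fun j => (Fintype.card (κ j) : ℝ) *
        Real.log (√(w τ j) * l j / √(D τ j))) (fun i _ => hterm0 τ i)
        (Finset.mem_univ j)).trans (hrate τ)
    rw [h2, hP, mul_add]
    have hkK := hK j
    have hK0 : 0 < K := (hk0 j).trans_le hkK
    have := hterm0 τ j
    have := (hk0 j).le
    gcongr
  refine ⟨Finset.univ.biUnion fun τ => Fintype.piFinset (Cb τ), ?_, ?_⟩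
  · have hpi : ∀ τ, ((Fintype.piFinset (Cb τ)).card : ℝ) ≤ Real.exp S * P ^ Fintype.card ι := by
      intro τ
      rw [Fintype.card_piFinset, Nat.cast_prod]
      calc ∏ j, ((Cb τ j).card : ℝ) ≤ ∏ j, (Real.exp ((Fintype.card (κ j) : ℝ) *
            Real.log (√(w τ j) * l j / √(D τ j))) * P) :=
            Finset.prod_le_prod (fun _ _ => Nat.cast_nonneg _) fun j _ => hCP τ j
        _ = Real.exp (∑ j, (Fintype.card (κ j) : ℝ) * Real.log (√(w τ j) * l j / √(D τ j)))
            * P ^ Fintype.card ι := by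
            rw [Finset.prod_mul_distrib, Finset.prod_const, Real.exp_sum, Finset.card_univ]
        _ ≤ _ := by
            rcases isEmpty_or_nonempty ι with hι | ⟨⟨j⟩⟩
            · have := hrate τ
              rw [Fintype.card_eq_zero, pow_zero, mul_one, mul_one]
              exact Real.exp_le_exp.2 this
            · have hS0 : 0 ≤ S := (Finset.sum_nonneg fun j _ => hterm0 τ j).trans (hrate τ)
              have hK0 : 0 < K := (hk0 j).trans_le (hK j)
              have hP0 : 0 ≤ P := by positivity
              exact mul_le_mul_of_nonneg_right (Real.exp_le_exp.2 (hrate τ)) (pow_nonneg hP0 _)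
    calc (((Finset.univ.biUnion fun τ => Fintype.piFinset (Cb τ)).card : ℕ) : ℝ)
        ≤ ∑ τ, ((Fintype.piFinset (Cb τ)).card : ℝ) := by exact_mod_cast Finset.card_biUnion_le
      _ ≤ ∑ τ : ι → Fin (L + 1), Real.exp S * P ^ Fintype.card ι :=
          Finset.sum_le_sum fun τ _ => hpi τ
      _ = _ := by
          rw [Finset.sum_const, Finset.card_univ, Fintype.card_fun, Fintype.card_fin, nsmul_eq_mul,
            mul_pow]
          push_cast
          ring
  · intro v hv
    set a : ι → ℝ := fun j => ‖v j‖ ^ 2 / l j ^ 2 with ha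
    have ha0 : ∀ j, 0 ≤ a j := fun j => by positivity
    have ha1 : ∀ j, a j ≤ 1 := fun j =>
      (Finset.single_le_sum (f := a) (fun i _ => ha0 i) (Finset.mem_univ j)).trans hv
    let τ : ι → Fin (L + 1) := fun j => ⟨⌊L * a j⌋₊, by
      rw [Nat.lt_succ_iff]
      exact Nat.floor_le_of_le (by nlinarith [ha1 j])⟩
    have hwa : ∀ j, a j ≤ w τ j := fun j => by
      simp only [w, τ]
      rw [le_div_iff₀ hL0, mul_comm]
      exact (Nat.lt_floor_add_one _).le
    have hwa' : ∀ j, w τ j ≤ a j + 1 / L := fun j => by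
      simp only [w, τ]
      have h1 := Nat.floor_le (mul_nonneg hL0.le (ha0 j))
      rw [div_le_iff₀ hL0, add_mul, one_div_mul_cancel hL0.ne']
      linarith
    have hv' : ∀ j, ‖v j‖ ≤ √(w τ j) * l j := fun j => by
      have h1 : ‖v j‖ ^ 2 ≤ w τ j * l j ^ 2 := by
        have := hwa j
        rwa [ha, div_le_iff₀ (by have := hl0 j; positivity)] at this
      rw [← Real.sqrt_sq (hl0 j).le, ← Real.sqrt_mul (hw τ j).le]
      exact Real.le_sqrt_of_sq_le h1
    choose c hc hdist using fun j => hCcov τ j (v j) (hv' j)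
    refine ⟨c, Finset.mem_biUnion.2 ⟨τ, Finset.mem_univ _, Fintype.mem_piFinset.2 hc⟩, ?_⟩
    calc ∑ j, dist (v j) (c j) ^ 2 ≤ ∑ j, (1 + η) ^ 2 * D τ j :=
          Finset.sum_le_sum fun j _ => by
            rw [← Real.sq_sqrt (hD0 τ j).le, ← mul_pow]
            exact pow_le_pow_left₀ dist_nonneg (hdist j) 2
      _ = (1 + η) ^ 2 * ε ^ 2 * ∑ j, w τ j := by rw [← Finset.mul_sum, hDsum]; ring
      _ ≤ (1 + η) ^ 2 * ε ^ 2 * ∑ j, (a j + 1 / L) := by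
          gcongr with j
          exact hwa' j
      _ = _ := by
          rw [Finset.sum_add_distrib, Finset.sum_const, Finset.card_univ, nsmul_eq_mul,
            mul_one_div]

/-- Sums over a finite set, grouped along the fibres of `g`, with subtypes as index types. -/
theorem sum_image_sum_filter_coe (F : Finset ℕ) (g : ℕ → ℕ) (f : ℕ → ℝ) :
    ∑ j : ↥(F.image g), ∑ n : ↥(F.filter fun n => g n = j), f n = ∑ n ∈ F, f n := by
  rw [← Finset.sum_fiberwise_of_maps_to (t := F.image g) (g := g)
    (fun n hn => Finset.mem_image_of_mem g hn) f,
    ← Finset.sum_coe_sort (F.image g) fun j => ∑ n ∈ F.filter fun n => g n = j, f n]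
  exact Finset.sum_congr rfl fun j _ => Finset.sum_coe_sort (F.filter fun n => g n = j) f

section Operator

variable {H : Type*} [NormedAddCommGroup H] [InnerProductSpace ℝ H]

/-- Parseval's identity along an orthonormal sequence with dense span. -/
theorem hasSum_inner_sq_of_orthonormal [CompleteSpace H] {ψ : ℕ → H} (hON : Orthonormal ℝ ψ)
    (hdense : (Submodule.span ℝ (Set.range ψ)).topologicalClosure = ⊤) (x : H) :
    HasSum (fun n => (inner ℝ (ψ n) x : ℝ) ^ 2) (‖x‖ ^ 2) := by
  have h := (HilbertBasis.mk hON hdense.ge).hasSum_inner_mul_inner x x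
  simp only [HilbertBasis.coe_mk, real_inner_self_eq_norm_sq] at h
  refine h.congr_fun fun n => ?_
  rw [real_inner_comm x, sq]

/-- Distance from a point of the image of the unit ball to a finite combination of eigenvectors. -/
theorem norm_sub_sum_sq_le [CompleteSpace H] {T : H →L[ℝ] H} (hposop : T.IsPositive) {ψ : ℕ → H}
    (hON : Orthonormal ℝ ψ)
    (hdense : (Submodule.span ℝ (Set.range ψ)).topologicalClosure = ⊤) {lam : ℕ → ℝ}
    (heig : ∀ n, T (ψ n) = lam n • ψ n) (hlampos : ∀ n, 0 < lam n) {ε : ℝ} {F : Finset ℕ}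
    (hF : ∀ n, n ∈ F ↔ ε ≤ lam n) (d : ℕ → ℝ) {z : H} (hz : ‖z‖ ≤ 1) :
    ‖T z - ∑ n ∈ F, d n • ψ n‖ ^ 2 ≤ ∑ n ∈ F, (lam n * inner ℝ (ψ n) z - d n) ^ 2
      + ε ^ 2 * (1 - ∑ n ∈ F, (inner ℝ (ψ n) z : ℝ) ^ 2) := by
  classical
  have hcoord : ∀ n, (inner ℝ (ψ n) (T z) : ℝ) = lam n * inner ℝ (ψ n) z := fun n => by
    have := hposop.isSymmetric (ψ n) z
    simp only [ContinuousLinearMap.coe_coe] at this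
    rw [← this, heig, inner_smul_left]
    simp
  have hy : ∀ n, (inner ℝ (ψ n) (T z - ∑ n ∈ F, d n • ψ n) : ℝ)
      = lam n * inner ℝ (ψ n) z - if n ∈ F then d n else 0 := fun n => by
    rw [inner_sub_right, hcoord, inner_sum]
    simp only [inner_smul_right, orthonormal_iff_ite.1 hON, mul_ite, mul_one, mul_zero,
      Finset.sum_ite_eq]
  have h1 := hasSum_inner_sq_of_orthonormal hON hdense (T z - ∑ n ∈ F, d n • ψ n)
  have h2 := (hasSum_inner_sq_of_orthonormal hON hdense z).mul_left (ε ^ 2)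
  have h3 := sum_le_hasSum F (fun n hn => ?_) (h2.sub h1)
  · simp only [hy] at h3
    rw [Finset.sum_sub_distrib, ← Finset.mul_sum] at h3
    have h4 : ∑ n ∈ F, (lam n * inner ℝ (ψ n) z - if n ∈ F then d n else 0) ^ 2
        = ∑ n ∈ F, (lam n * inner ℝ (ψ n) z - d n) ^ 2 :=
      Finset.sum_congr rfl fun n hn => by rw [if_pos hn]
    rw [h4] at h3
    have h5 : ‖z‖ ^ 2 ≤ 1 := by nlinarith [norm_nonneg z]
    nlinarith [mul_le_mul_of_nonneg_left h5 (sq_nonneg ε)]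
  · rw [hy, if_neg hn, sub_zero, mul_pow, sub_nonneg]
    have hlt : lam n < ε := by
      by_contra! h; exact hn ((hF n).2 h)
    have := hlampos n
    gcongr

/-- A cover of the image of the unit ball, for an arbitrary grouping `g` of the eigenvalues
above `ε` into levels `l`. -/
theorem exists_cover_image_unitBall [CompleteSpace H] {T : H →L[ℝ] H} (hposop : T.IsPositive)
    {ψ : ℕ → H} (hON : Orthonormal ℝ ψ)
    (hdense : (Submodule.span ℝ (Set.range ψ)).topologicalClosure = ⊤) {lam : ℕ → ℝ}
    (heig : ∀ n, T (ψ n) = lam n • ψ n) (hlampos : ∀ n, 0 < lam n) {ε η : ℝ} (hε : 0 < ε)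
    (hη : 0 < η) (hη1 : η ≤ 1) {F : Finset ℕ} (hF : ∀ n, n ∈ F ↔ ε ≤ lam n) (g : ℕ → ℕ)
    (l : ℕ → ℝ) (hl : ∀ j, ε ≤ l j) (hlam : ∀ n ∈ F, lam n ≤ l (g n)) {L : ℕ} (hL : 0 < L)
    (hgL : ((F.image g).card : ℝ) ≤ η * L) {S : ℝ}
    (hS : ∑ n ∈ F, Real.log (l (g n) / ε) ≤ S) :
    ∃ s : Finset H, (s.card : ℝ) ≤ Real.exp S *
        ((L + 1) * (2 * Real.exp 1 * F.card * (F.card * Real.log (3 / η) + S) + 2))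
          ^ (F.image g).card ∧
      ∀ x ∈ closure (T '' Metric.closedBall 0 1), ∃ y ∈ s, dist x y ≤ (1 + η) ^ 2 * ε := by
  classical
  have hL0 : (0 : ℝ) < L := by exact_mod_cast hL
  have hl0 : ∀ j, 0 < l j := fun j => hε.trans_le (hl j)
  have hne : ∀ j : ↥(F.image g), Nonempty ↥(F.filter fun n => g n = j) := by
    rintro ⟨j, hj⟩
    obtain ⟨n, hn, rfl⟩ := Finset.mem_image.1 hj
    exact ⟨⟨n, Finset.mem_filter.2 ⟨hn, rfl⟩⟩⟩
  obtain ⟨C, hCcard, hCcov⟩ := exists_cover_block_ellipsoid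
    (κ := fun j : ↥(F.image g) => ↥(F.filter fun n => g n = j)) (fun j => l j) hε hη hη1
    (fun j => hl j) L hL S F.card
    (by
      refine le_trans (le_of_eq ?_) hS
      rw [← sum_image_sum_filter_coe F g fun n => Real.log (l (g n) / ε)]
      refine Finset.sum_congr rfl fun j _ => ?_
      rw [← nsmul_eq_mul, ← Finset.card_univ, ← Finset.sum_const]
      exact Finset.sum_congr rfl fun n _ => by rw [(Finset.mem_filter.1 n.2).2])
    (fun j => by
      rw [Fintype.card_coe]
      exact_mod_cast Finset.card_filter_le _ _)
  let d : (∀ j : ↥(F.image g), EuclideanSpace ℝ ↥(F.filter fun n => g n = j)) → ℕ → ℝ :=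
    fun c n => if hn : n ∈ F then
      c ⟨g n, Finset.mem_image_of_mem g hn⟩ ⟨n, Finset.mem_filter.2 ⟨hn, rfl⟩⟩ else 0
  have hd : ∀ c (j : ↥(F.image g)) (n : ↥(F.filter fun n => g n = j)), d c n = c j n := by
    rintro c ⟨j, hj⟩ ⟨n, hn⟩
    obtain ⟨hnF, rfl⟩ := Finset.mem_filter.1 hn
    simp [d, hnF]
  refine ⟨C.image fun c => ∑ n ∈ F, d c n • ψ n, ?_, ?_⟩
  · refine le_trans (by exact_mod_cast Finset.card_image_le) (hCcard.trans (le_of_eq ?_))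
    rw [Fintype.card_coe]
  have hcover : T '' Metric.closedBall 0 1 ⊆
      ⋃ y ∈ C.image fun c => ∑ n ∈ F, d c n • ψ n, Metric.closedBall y ((1 + η) ^ 2 * ε) := by
    rintro _ ⟨z, hz, rfl⟩
    rw [Metric.mem_closedBall, dist_zero_right] at hz
    let v : ∀ j : ↥(F.image g), EuclideanSpace ℝ ↥(F.filter fun n => g n = j) :=
      fun j => WithLp.toLp 2 fun n => lam n * inner ℝ (ψ n) z
    have hvl : ∑ j, ‖v j‖ ^ 2 / l j ^ 2 ≤ ∑ n ∈ F, (inner ℝ (ψ n) z : ℝ) ^ 2 := by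
      rw [← sum_image_sum_filter_coe F g fun n => (inner ℝ (ψ n) z : ℝ) ^ 2]
      refine Finset.sum_le_sum fun j _ => ?_
      rw [EuclideanSpace.norm_sq_eq, Finset.sum_div]
      refine Finset.sum_le_sum fun n _ => ?_
      obtain ⟨hnF, hnj⟩ := Finset.mem_filter.1 n.2
      have h1 := hlam n hnF
      rw [hnj] at h1
      have h2 : lam n ^ 2 ≤ l j ^ 2 := pow_le_pow_left₀ (hlampos n).le h1 2
      have h3 := hl0 j
      rw [div_le_iff₀ (by positivity), Real.norm_eq_abs, sq_abs]
      simp only [v]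
      rw [mul_pow, mul_comm]
      exact mul_le_mul_of_nonneg_left h2 (sq_nonneg _)
    have hbessel : ∑ n ∈ F, (inner ℝ (ψ n) z : ℝ) ^ 2 ≤ 1 := by
      have h1 := sum_le_hasSum F (fun n _ => sq_nonneg _)
        (hasSum_inner_sq_of_orthonormal hON hdense z)
      nlinarith [norm_nonneg z]
    obtain ⟨c, hc, hdist⟩ := hCcov v (hvl.trans hbessel)
    refine Set.mem_iUnion₂.2 ⟨_, Finset.mem_image_of_mem _ hc, ?_⟩
    rw [Metric.mem_closedBall, dist_eq_norm]
    refine (sq_le_sq₀ (norm_nonneg _) (by positivity)).1 ?_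
    refine (norm_sub_sum_sq_le hposop hON hdense heig hlampos hF (d c) hz).trans ?_
    have hsum : ∑ n ∈ F, (lam n * inner ℝ (ψ n) z - d c n) ^ 2 = ∑ j, dist (v j) (c j) ^ 2 := by
      rw [← sum_image_sum_filter_coe F g fun n => (lam n * inner ℝ (ψ n) z - d c n) ^ 2]
      refine Finset.sum_congr rfl fun j _ => ?_
      rw [EuclideanSpace.dist_eq, Real.sq_sqrt (Finset.sum_nonneg fun _ _ => sq_nonneg _)]
      refine Finset.sum_congr rfl fun n _ => ?_
      rw [hd, Real.dist_eq, sq_abs]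
    rw [hsum]
    rw [Fintype.card_coe] at hdist
    set a := ∑ n ∈ F, (inner ℝ (ψ n) z : ℝ) ^ 2 with ha
    have ha0 : 0 ≤ a := Finset.sum_nonneg fun _ _ => sq_nonneg _
    have hq : ((F.image g).card : ℝ) / L ≤ η := by rwa [div_le_iff₀ hL0]
    have hE : 0 < ε ^ 2 := by positivity
    have h1 : ∑ j, dist (v j) (c j) ^ 2 ≤ (1 + η) ^ 2 * ε ^ 2 * (a + η) :=
      hdist.trans (mul_le_mul_of_nonneg_left (add_le_add hvl hq) (by positivity))
    have h2 : ε ^ 2 * (1 - a) ≤ (1 + η) ^ 2 * ε ^ 2 * (1 - a) := by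
      refine mul_le_mul_of_nonneg_right ?_ (by linarith)
      exact le_mul_of_one_le_left hE.le (by nlinarith)
    calc _ ≤ (1 + η) ^ 2 * ε ^ 2 * (1 + η) := by linarith
      _ ≤ (1 + η) ^ 2 * ε ^ 2 * (1 + η) ^ 2 := by
          refine mul_le_mul_of_nonneg_left ?_ (by positivity)
          nlinarith
      _ = _ := by ring
  intro x hx
  have hclosed : IsClosed (⋃ y ∈ C.image fun c => ∑ n ∈ F, d c n • ψ n,
      Metric.closedBall y ((1 + η) ^ 2 * ε)) :=
    Set.Finite.isClosed_biUnion (Finset.finite_toSet _) fun _ _ => Metric.isClosed_closedBall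
  obtain ⟨y, hy, hxy⟩ := Set.mem_iUnion₂.1 (closure_minimal hcover hclosed hx)
  exact ⟨y, hy, hxy⟩

end Operator

section OperatorLower

variable {H : Type*} [NormedAddCommGroup H] [InnerProductSpace ℝ H]

/-- The image of the unit ball under a diagonal map of Euclidean space cannot be covered by too
few balls. -/
theorem prod_le_card_mul_pow_of_cover_diagonal {ι : Type*} [Fintype ι] [DecidableEq ι] (a : ι → ℝ)
    (ha : ∀ i, 0 < a i)
    {ε : ℝ} (hε : 0 < ε) (s : Finset (EuclideanSpace ℝ ι))
    (hs : ∀ v : EuclideanSpace ℝ ι, ‖v‖ ≤ 1 → ∃ y ∈ s, dist (WithLp.toLp 2 fun i => a i * v i) y ≤ ε) :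
    ∏ i, a i ≤ s.card * ε ^ Fintype.card ι := by
  let b := (EuclideanSpace.basisFun ι ℝ).toBasis
  let D := Matrix.toLin b b (Matrix.diagonal a)
  have hD : ∀ v, D v = WithLp.toLp 2 fun i => a i * v i := fun v => by
    ext i
    simp [D, Matrix.toLin_apply, b, Matrix.mulVec_diagonal]
    simp [Pi.single_apply, mul_comm]
  have hdet : LinearMap.det D = ∏ i, a i := by
    rw [LinearMap.det_toLin, Matrix.det_diagonal]
  have hprod : 0 < ∏ i, a i := Finset.prod_pos fun i _ => ha i
  have hvol := Measure.addHaar_image_linearMap (volume : Measure (EuclideanSpace ℝ ι)) D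
    (Metric.closedBall 0 1)
  have hsub : D '' Metric.closedBall 0 1 ⊆ ⋃ y ∈ s, Metric.closedBall y ε := by
    rintro _ ⟨v, hv, rfl⟩
    obtain ⟨y, hy, h⟩ := hs v (by simpa using hv)
    exact Set.mem_iUnion₂.2 ⟨y, hy, by rwa [Metric.mem_closedBall, hD]⟩
  have h1 : ENNReal.ofReal (∏ i, a i) * volume (Metric.closedBall (0 : EuclideanSpace ℝ ι) 1)
      ≤ ENNReal.ofReal (s.card * ε ^ Fintype.card ι)
        * volume (Metric.closedBall (0 : EuclideanSpace ℝ ι) 1) := by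
    rw [← abs_of_pos hprod, ← hdet, ← hvol]
    refine (measure_mono hsub).trans ((measure_biUnion_finset_le _ _).trans (le_of_eq ?_))
    have : ∀ y : EuclideanSpace ℝ ι, volume (Metric.closedBall y ε)
        = ENNReal.ofReal (ε ^ Fintype.card ι)
          * volume (Metric.closedBall (0 : EuclideanSpace ℝ ι) 1) := fun y => by
      rw [Measure.addHaar_closedBall' _ _ hε.le, finrank_euclideanSpace]
    simp only [this, Finset.sum_const, nsmul_eq_mul]
    rw [ENNReal.ofReal_mul (by positivity), ENNReal.ofReal_natCast, mul_assoc]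
  rw [ENNReal.mul_le_mul_iff_left (Metric.measure_closedBall_pos _ _ one_pos).ne'
    measure_closedBall_lt_top.ne] at h1
  exact (ENNReal.ofReal_le_ofReal_iff (by positivity)).1 h1

/-- Volume lower bound for the size of a cover of the image of the unit ball. -/
theorem sum_log_le_log_card_of_cover {T : H →L[ℝ] H} {ψ : ℕ → H} (hON : Orthonormal ℝ ψ)
    {lam : ℕ → ℝ} (heig : ∀ n, T (ψ n) = lam n • ψ n) (hlampos : ∀ n, 0 < lam n) {ε : ℝ}
    (hε : 0 < ε) (F : Finset ℕ) (s : Finset H)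
    (hs : ∀ x ∈ closure (T '' Metric.closedBall 0 1), ∃ y ∈ s, dist x y ≤ ε) :
    ∑ n ∈ F, Real.log (lam n / ε) ≤ Real.log s.card := by
  classical
  let P : H → EuclideanSpace ℝ ↥F := fun x => WithLp.toLp 2 fun n => inner ℝ (ψ n) x
  have hP : ∀ x y, dist (P x) (P y) ≤ dist x y := fun x y => by
    rw [EuclideanSpace.dist_eq, dist_eq_norm x y]
    refine Real.sqrt_le_iff.2 ⟨norm_nonneg _, ?_⟩
    have h := hON.sum_inner_products_le (x - y) (s := F)
    rw [← Finset.sum_coe_sort F] at h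
    refine le_trans (le_of_eq (Finset.sum_congr rfl fun n _ => ?_)) h
    simp only [P, Real.dist_eq, inner_sub_right, Real.norm_eq_abs]
  have key : ∏ n : ↥F, lam n ≤ (s.image P).card * ε ^ Fintype.card ↥F := by
    refine prod_le_card_mul_pow_of_cover_diagonal (fun n : ↥F => lam n) (fun n => hlampos n) hε _
      fun v hv => ?_
    let z : H := ∑ n : ↥F, v n • ψ n
    have hz : ‖z‖ ≤ 1 := by
      have hsq : ‖z‖ ^ 2 = ‖v‖ ^ 2 := by
        rw [EuclideanSpace.norm_sq_eq, ← real_inner_self_eq_norm_sq]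
        have hON' := hON.comp (fun n : ↥F => (n : ℕ)) Subtype.val_injective
        have := hON'.inner_sum (fun n => v n) (fun n => v n) Finset.univ
        simp only [Function.comp_apply] at this
        rw [this]
        refine Finset.sum_congr rfl fun n _ => ?_
        simp [sq]
      have := norm_nonneg z
      nlinarith [norm_nonneg v]
    obtain ⟨y, hy, hxy⟩ := hs (T z) (subset_closure ⟨z, by simpa using hz, rfl⟩)
    refine ⟨P y, Finset.mem_image_of_mem P hy, le_trans (le_of_eq ?_) ((hP _ _).trans hxy)⟩
    congr 1
    ext n
    simp only [P, z, map_sum, map_smul, heig, inner_sum, inner_smul_right,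
      orthonormal_iff_ite.1 hON]
    rw [Finset.sum_eq_single n]
    · simp [mul_comm]
    · intro m _ hm
      have : (n : ℕ) ≠ m := fun h => hm (Subtype.ext h.symm)
      simp [this]
    · simp
  have hle : ∏ n ∈ F, lam n ≤ s.card * ε ^ F.card := by
    rw [Finset.prod_coe_sort F lam, Fintype.card_coe] at key
    refine key.trans (mul_le_mul_of_nonneg_right ?_ (by positivity))
    exact_mod_cast Finset.card_image_le
  rw [← Real.log_prod (fun n _ => (div_pos (hlampos n) hε).ne')]
  refine Real.log_le_log (Finset.prod_pos fun n _ => div_pos (hlampos n) hε) ?_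
  rw [Finset.prod_div_distrib, Finset.prod_const, div_le_iff₀ (by positivity)]
  exact hle

end OperatorLower

/-- A power of a small argument with negative exponent exceeds every constant. -/
theorem eventually_le_rpow_neg {β : ℝ} (hβ : 0 < β) (C : ℝ) :
    ∀ᶠ e : ℝ in 𝓝[>] 0, C ≤ e ^ (-β) :=
  (tendsto_rpow_neg_nhdsGT_zero (by linarith)).eventually_ge_atTop C

theorem natCard_setOf_eq_card_filter {lam : ℕ → ℝ} {e γ : ℝ} (h : e ≤ γ) {F : Finset ℕ}
    (hF : ∀ n, n ∈ F ↔ e ≤ lam n) :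
    Nat.card {n : ℕ | γ ≤ lam n} = (F.filter fun n => γ ≤ lam n).card := by
  rw [← Set.ncard_coe_finset]
  refine congrArg Set.ncard (Set.ext fun n => ?_)
  simp only [Finset.coe_filter, Set.mem_ofPred_eq, hF]
  exact ⟨fun h2 => ⟨h.trans h2, h2⟩, fun h2 => h2.2⟩

theorem integral_indicator_Iic_inv {e b t : ℝ} (he : 0 < e) (heb : e ≤ b) (het : e ≤ t) :
    ∫ γ in e..b, (Set.Iic t).indicator (fun γ => γ⁻¹) γ = Real.log (min b t / e) := by
  rw [intervalIntegral.integral_of_le heb, setIntegral_indicator measurableSet_Iic,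
    Set.Ioc_inter_Iic, ← intervalIntegral.integral_of_le (le_min heb het),
    integral_inv_of_pos he (lt_min (he.trans_le heb) (he.trans_le het))]

theorem intervalIntegrable_rpow_of_pos {e b r : ℝ} (he : 0 < e) (heb : e ≤ b) :
    IntervalIntegrable (fun γ : ℝ => γ ^ r) volume e b := by
  refine intervalIntegral.intervalIntegrable_rpow (Or.inr ?_)
  rw [Set.uIcc_of_le heb]
  exact fun h => absurd h.1 (not_le.2 he)

theorem integral_rpow_neg_sub_one {e b β : ℝ} (he : 0 < e) (heb : e ≤ b) (hβ : 0 < β) :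
    ∫ γ in e..b, γ ^ (-β - 1) = (e ^ (-β) - b ^ (-β)) / β := by
  rw [integral_rpow]
  · rw [show -β - 1 + 1 = -β by ring]
    field_simp
    ring
  · refine Or.inr ⟨by linarith, ?_⟩
    rw [Set.uIcc_of_le heb]
    exact fun h => absurd h.1 (not_le.2 he)

/-- Two-term expansion of the logarithmic sum associated with a counting function. -/
theorem eventually_abs_sum_log_sub_le {lam : ℕ → ℝ} (hfin : ∀ e > 0, {n | e ≤ lam n}.Finite)
    {κ₁ κ₂ β₁ β₂ : ℝ} (hβ₁ : 0 < β₁) (hβ₂ : 0 < β₂)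
    (hasymp : (fun γ : ℝ => (Nat.card {n : ℕ | γ ≤ lam n} : ℝ)
        - κ₁ * γ ^ (-β₁) - κ₂ * γ ^ (-β₂)) =o[𝓝[>] 0] fun γ : ℝ => γ ^ (-β₂))
    {c : ℝ} (hc : 0 < c) :
    ∀ᶠ e : ℝ in 𝓝[>] 0, ∀ F : Finset ℕ, (∀ n, n ∈ F ↔ e ≤ lam n) →
      |∑ n ∈ F, Real.log (lam n / e) - (κ₁ / β₁ * e ^ (-β₁) + κ₂ / β₂ * e ^ (-β₂))|
        ≤ c * e ^ (-β₂) := by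
  have h1 := hasymp.bound (show 0 < c / 2 * β₂ by positivity)
  rw [eventually_nhdsWithin_iff, Metric.eventually_nhds_iff] at h1
  obtain ⟨r, hr, h1⟩ := h1
  set b := r / 2 with hb
  have hb0 : 0 < b := by positivity
  have hbound : ∀ γ, 0 < γ → γ ≤ b → |(Nat.card {n : ℕ | γ ≤ lam n} : ℝ)
        - κ₁ * γ ^ (-β₁) - κ₂ * γ ^ (-β₂)| ≤ c / 2 * β₂ * γ ^ (-β₂) := fun γ h0 hle => by
    have := @h1 γ (by rw [Real.dist_eq, sub_zero, abs_of_pos h0]; linarith) h0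
    rwa [Real.norm_eq_abs, Real.norm_eq_abs, abs_of_pos (Real.rpow_pos_of_pos h0 _)] at this
  set G := (hfin b hb0).toFinset with hG
  set C := |∑ n ∈ G, Real.log (lam n / b)| + |κ₁ / β₁ * b ^ (-β₁)| + |κ₂ / β₂ * b ^ (-β₂)| with hC
  have hev : ∀ᶠ e : ℝ in 𝓝[>] 0, e ∈ Set.Ioo 0 b := Ioo_mem_nhdsGT hb0
  filter_upwards [eventually_le_rpow_neg hβ₂ (2 * C / c), hev] with e hCe ⟨he, heb⟩ F hF
  have hsplit : ∑ n ∈ F, Real.log (lam n / e)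
      = ∑ n ∈ F, Real.log (min b (lam n) / e) + ∑ n ∈ G, Real.log (lam n / b) := by
    have hGF : G = F.filter fun n => b ≤ lam n := by
      ext n
      simp only [hG, Set.Finite.mem_toFinset, Set.mem_ofPred_eq, Finset.mem_filter, hF]
      exact ⟨fun h => ⟨heb.le.trans h, h⟩, fun h => h.2⟩
    rw [hGF, Finset.sum_filter, ← Finset.sum_add_distrib]
    refine Finset.sum_congr rfl fun n hn => ?_
    have h3 : 0 < lam n := he.trans_le ((hF n).1 hn)
    split_ifs with h
    · rw [min_eq_left h, Real.log_div hb0.ne' he.ne', Real.log_div h3.ne' he.ne',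
        Real.log_div h3.ne' hb0.ne']
      ring
    · rw [min_eq_right (not_le.1 h).le, add_zero]
  have hind : ∀ n ∈ F, IntervalIntegrable
      ((Set.Iic (lam n)).indicator fun γ : ℝ => γ⁻¹) volume e b := fun n _ => by
    rw [intervalIntegrable_iff_integrableOn_Ioc_of_le heb.le]
    refine IntegrableOn.indicator ?_ measurableSet_Iic
    rw [← intervalIntegrable_iff_integrableOn_Ioc_of_le heb.le]
    simpa [Real.rpow_neg_one] using intervalIntegrable_rpow_of_pos (r := -1) he heb.le
  have hintegral : ∑ n ∈ F, Real.log (min b (lam n) / e)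
      = ∫ γ in e..b, ∑ n ∈ F, (Set.Iic (lam n)).indicator (fun γ : ℝ => γ⁻¹) γ := by
    rw [intervalIntegral.integral_finsetSum hind]
    exact Finset.sum_congr rfl fun n hn =>
      (integral_indicator_Iic_inv he heb.le ((hF n).1 hn)).symm
  have hi1 := (intervalIntegrable_rpow_of_pos (r := -β₁ - 1) he heb.le).const_mul κ₁
  have hi2 := (intervalIntegrable_rpow_of_pos (r := -β₂ - 1) he heb.le).const_mul κ₂
  have hi3 := (intervalIntegrable_rpow_of_pos (r := -β₂ - 1) he heb.le).const_mul (c / 2 * β₂)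
  have hi0 : IntervalIntegrable (fun γ =>
      ∑ n ∈ F, (Set.Iic (lam n)).indicator (fun γ : ℝ => γ⁻¹) γ) volume e b := by
    simpa only [Finset.sum_fn] using IntervalIntegrable.sum F hind
  have hmain := intervalIntegral.norm_integral_le_of_norm_le heb.le
    (f := fun γ => ∑ n ∈ F, (Set.Iic (lam n)).indicator (fun γ : ℝ => γ⁻¹) γ
      - κ₁ * γ ^ (-β₁ - 1) - κ₂ * γ ^ (-β₂ - 1))
    (g := fun γ => c / 2 * β₂ * γ ^ (-β₂ - 1)) (ae_of_all _ fun γ hγ => ?_) hi3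
  · rw [intervalIntegral.integral_sub (hi0.sub hi1) hi2, intervalIntegral.integral_sub hi0 hi1,
      ← hintegral, intervalIntegral.integral_const_mul, intervalIntegral.integral_const_mul,
      intervalIntegral.integral_const_mul, integral_rpow_neg_sub_one he heb.le hβ₁,
      integral_rpow_neg_sub_one he heb.le hβ₂, Real.norm_eq_abs] at hmain
    have hlast : C ≤ c / 2 * e ^ (-β₂) := by
      rw [div_le_iff₀ hc] at hCe
      linarith
    have hright : c / 2 * β₂ * ((e ^ (-β₂) - b ^ (-β₂)) / β₂) ≤ c / 2 * e ^ (-β₂) := by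
      have := Real.rpow_pos_of_pos hb0 (-β₂)
      rw [show c / 2 * β₂ * ((e ^ (-β₂) - b ^ (-β₂)) / β₂) = c / 2 * (e ^ (-β₂) - b ^ (-β₂)) by
        field_simp]
      gcongr
      linarith
    rw [hsplit]
    have e1 : ∑ n ∈ F, Real.log (min b (lam n) / e) + ∑ n ∈ G, Real.log (lam n / b)
        - (κ₁ / β₁ * e ^ (-β₁) + κ₂ / β₂ * e ^ (-β₂))
        = (∑ n ∈ F, Real.log (min b (lam n) / e) - κ₁ * ((e ^ (-β₁) - b ^ (-β₁)) / β₁)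
            - κ₂ * ((e ^ (-β₂) - b ^ (-β₂)) / β₂))
          + (∑ n ∈ G, Real.log (lam n / b) - κ₁ / β₁ * b ^ (-β₁) - κ₂ / β₂ * b ^ (-β₂)) := by
      ring
    rw [e1]
    have e2 := abs_sub (∑ n ∈ G, Real.log (lam n / b) - κ₁ / β₁ * b ^ (-β₁))
      (κ₂ / β₂ * b ^ (-β₂))
    have e3 := abs_sub (∑ n ∈ G, Real.log (lam n / b)) (κ₁ / β₁ * b ^ (-β₁))
    refine (abs_add_le _ _).trans ?_
    linarith
  · have hγ0 : 0 < γ := he.trans hγ.1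
    have hs : ∑ n ∈ F, (Set.Iic (lam n)).indicator (fun γ : ℝ => γ⁻¹) γ
        = (Nat.card {n : ℕ | γ ≤ lam n} : ℝ) * γ⁻¹ := by
      rw [natCard_setOf_eq_card_filter hγ.1.le hF, ← nsmul_eq_mul, ← Finset.sum_const,
        Finset.sum_filter]
      exact Finset.sum_congr rfl fun n _ => by simp [Set.indicator_apply]
    rw [hs, Real.rpow_sub_one hγ0.ne', Real.rpow_sub_one hγ0.ne', Real.norm_eq_abs,
      show (Nat.card {n : ℕ | γ ≤ lam n} : ℝ) * γ⁻¹ - κ₁ * (γ ^ (-β₁) / γ) - κ₂ * (γ ^ (-β₂) / γ)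
        = ((Nat.card {n : ℕ | γ ≤ lam n} : ℝ) - κ₁ * γ ^ (-β₁) - κ₂ * γ ^ (-β₂)) * γ⁻¹ by ring,
      abs_mul, abs_of_pos (inv_pos.2 hγ0),
      show c / 2 * β₂ * (γ ^ (-β₂) / γ) = c / 2 * β₂ * γ ^ (-β₂) * γ⁻¹ by ring]
    exact mul_le_mul_of_nonneg_right (hbound γ hγ0 hγ.2) (inv_pos.2 hγ0).le

section OperatorUpper

variable {H : Type*} [NormedAddCommGroup H] [InnerProductSpace ℝ H]

/-- Lowering the threshold from `e` to `e / (1 + η) ^ 2` changes the logarithmic sum by at most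
`2 η` per index. -/
theorem sum_log_div_le_sum_log_div_add {lam : ℕ → ℝ} (hlampos : ∀ n, 0 < lam n) {e η : ℝ}
    (he : 0 < e) (hη : 0 < η) {F Fe : Finset ℕ} (hF : ∀ n, n ∈ F ↔ e / (1 + η) ^ 2 ≤ lam n)
    (hFe : ∀ n, n ∈ Fe ↔ e ≤ lam n) :
    ∑ n ∈ F, Real.log (lam n / (e / (1 + η) ^ 2))
      ≤ ∑ n ∈ Fe, Real.log (lam n / e) + F.card * (2 * η) := by
  have hsub : Fe ⊆ F := fun n hn => (hF n).2 <|
    (div_le_self he.le (by nlinarith)).trans ((hFe n).1 hn)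
  have hlog : ∀ n, Real.log (lam n / (e / (1 + η) ^ 2)) ≤ Real.log (lam n / e) + 2 * η :=
    fun n => by
      rw [div_div_eq_mul_div, mul_comm, mul_div_assoc, Real.log_mul (by positivity)
        (div_pos (hlampos n) he).ne', Real.log_pow]
      have := Real.log_le_sub_one_of_pos (show 0 < 1 + η by positivity)
      push_cast
      linarith
  calc _ ≤ ∑ n ∈ F, (Real.log (lam n / e) + 2 * η) := Finset.sum_le_sum fun n _ => hlog n
    _ = ∑ n ∈ F, Real.log (lam n / e) + F.card * (2 * η) := by
      rw [Finset.sum_add_distrib, Finset.sum_const, nsmul_eq_mul]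
    _ ≤ _ := by
      rw [← Finset.sum_sdiff hsub]
      have : ∑ n ∈ F \ Fe, Real.log (lam n / e) ≤ 0 := Finset.sum_nonpos fun n hn => by
        have h1 : ¬ e ≤ lam n := fun h => (Finset.mem_sdiff.1 hn).2 ((hFe n).2 h)
        exact Real.log_nonpos (div_pos (hlampos n) he).le
          ((div_le_one he).2 (not_le.1 h1).le)
      linarith

theorem polynomial_factor_le_pow_six {E L k r S : ℝ} (hE : 104 ≤ E)
    (hL : L ≤ E * E + 2) (hk0 : 0 ≤ k) (hk : k ≤ E) (hr0 : 0 ≤ r) (hr : r ≤ 3 * E)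
    (hS0 : 0 ≤ S) (hS : S ≤ E ^ 2) :
    (L + 1) * (2 * Real.exp 1 * k * (k * r + S) + 2) ≤ E ^ 6 := by
  have hE0 : 0 < E := by linarith
  have h1 : L + 1 ≤ 4 * E ^ 2 := by nlinarith
  have h2 : 2 * Real.exp 1 * k * (k * r + S) + 2 ≤ 26 * E ^ 3 := by
    have h3 : 2 * Real.exp 1 * k * (k * r + S) ≤ 2 * 3 * E * (E * (3 * E) + E ^ 2) := by
      gcongr
      exact Real.exp_one_lt_three.le
    have h4 : 1 ≤ E ^ 3 := one_le_pow₀ (by linarith)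
    linarith
  calc _ ≤ 4 * E ^ 2 * (26 * E ^ 3) := by gcongr
    _ = 104 * E ^ 5 := by ring
    _ ≤ E * E ^ 5 := by gcongr
    _ = E ^ 6 := by ring

/-- A cover of the image of the unit ball whose cardinality is controlled by the logarithmic sum
of the eigenvalues, up to lower order terms. -/
theorem exists_cover_image_unitBall_log_card_le [CompleteSpace H] {T : H →L[ℝ] H}
    (hposop : T.IsPositive) {ψ : ℕ → H} (hON : Orthonormal ℝ ψ)
    (hdense : (Submodule.span ℝ (Set.range ψ)).topologicalClosure = ⊤) {lam : ℕ → ℝ}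
    (heig : ∀ n, T (ψ n) = lam n • ψ n) (hlampos : ∀ n, 0 < lam n) {e η x t C E : ℝ}
    (he : 0 < e) (hx : 1 ≤ x) (hη : η = 1 / x ^ 2) (ht : 1 ≤ t) (hE : 104 ≤ E)
    {F Fe : Finset ℕ} (hF : ∀ n, n ∈ F ↔ e / (1 + η) ^ 2 ≤ lam n)
    (hFe : ∀ n, n ∈ Fe ↔ e ≤ lam n) (hFC : (F.card : ℝ) ≤ C * x ^ 2)
    (hFt : ∀ n ∈ F, Real.log (lam n / (e / (1 + η) ^ 2)) ≤ 2 * t)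
    (hCE : C * x ^ 2 ≤ E) (hxtE : 3 * x * t ≤ E) (hxE : x ^ 2 ≤ E) :
    ∃ s : Finset H, (∀ y ∈ closure (T '' Metric.closedBall 0 1), ∃ z ∈ s, dist y z ≤ e) ∧
      Real.log s.card ≤ ∑ n ∈ Fe, Real.log (lam n / e) + 2 * C + C * x
        + 18 * x * t * Real.log E := by
  have hx0 : 0 < x := by linarith
  have hη0 : 0 < η := by rw [hη]; positivity
  have hη1 : η ≤ 1 := by
    rw [hη, div_le_one (by positivity)]
    nlinarith
  set ε := e / (1 + η) ^ 2 with hε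
  have hε0 : 0 < ε := by positivity
  set g : ℕ → ℕ := fun n => ⌊x * Real.log (lam n / ε)⌋₊ with hg
  set l : ℕ → ℝ := fun j => ε * Real.exp ((j + 1) / x) with hl
  have hlog : ∀ j, Real.log (l j / ε) = (j + 1) / x := fun j => by
    rw [hl, mul_div_cancel_left₀ _ hε0.ne', Real.log_exp]
  have hlog0 : ∀ n ∈ F, 0 ≤ Real.log (lam n / ε) := fun n hn =>
    Real.log_nonneg ((one_le_div hε0).2 ((hF n).1 hn))
  set J := (F.image g).card with hJ
  have hJle : (J : ℝ) ≤ 3 * x * t := by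
    have hsub : F.image g ⊆ Finset.range (⌊x * (2 * t)⌋₊ + 1) := by
      intro j hj
      obtain ⟨n, hn, rfl⟩ := Finset.mem_image.1 hj
      rw [Finset.mem_range, Nat.lt_succ_iff]
      exact Nat.floor_le_floor (mul_le_mul_of_nonneg_left (hFt n hn) hx0.le)
    have h1 := Finset.card_le_card hsub
    rw [Finset.card_range] at h1
    have h2 : (J : ℝ) ≤ ⌊x * (2 * t)⌋₊ + 1 := by exact_mod_cast h1
    have h3 := Nat.floor_le (show 0 ≤ x * (2 * t) by positivity)
    nlinarith
  set L := ⌈J * x ^ 2⌉₊ + 1 with hL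
  have hLge : (J : ℝ) * x ^ 2 ≤ L := by
    rw [hL]; push_cast
    linarith [Nat.le_ceil (J * x ^ 2 : ℝ)]
  have hLle : (L : ℝ) ≤ J * x ^ 2 + 2 := by
    rw [hL]; push_cast
    linarith [(Nat.ceil_lt_add_one (show 0 ≤ J * x ^ 2 by positivity)).le]
  set S := ∑ n ∈ F, Real.log (l (g n) / ε) with hS
  have hterm : ∀ n ∈ F, Real.log (l (g n) / ε) ≤ Real.log (lam n / ε) + 1 / x := fun n hn => by
    rw [hlog, add_div]
    refine add_le_add_left ?_ _
    rw [div_le_iff₀ hx0, mul_comm]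
    exact Nat.floor_le (mul_nonneg hx0.le (hlog0 n hn))
  have hS0 : 0 ≤ S := Finset.sum_nonneg fun n _ => by rw [hlog]; positivity
  have hk0 : (0 : ℝ) ≤ F.card := by positivity
  have hSE : S ≤ E ^ 2 := by
    have h1 : S ≤ ∑ n ∈ F, (3 * t) := Finset.sum_le_sum fun n hn => by
      have h2 : 1 / x ≤ 1 := (div_le_one hx0).2 hx
      linarith [hterm n hn, hFt n hn]
    rw [Finset.sum_const, nsmul_eq_mul] at h1
    have h3 : 3 * t ≤ E := by nlinarith
    calc S ≤ F.card * (3 * t) := h1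
      _ ≤ E * E := by gcongr; exact hFC.trans hCE
      _ = E ^ 2 := by ring
  have hSle : S ≤ ∑ n ∈ Fe, Real.log (lam n / e) + 2 * C + C * x := by
    have h1 := sum_log_div_le_sum_log_div_add hlampos he hη0 hF hFe
    rw [← hε] at h1
    have h2 : S ≤ ∑ n ∈ F, Real.log (lam n / ε) + F.card * (1 / x) := by
      refine (Finset.sum_le_sum hterm).trans (le_of_eq ?_)
      rw [Finset.sum_add_distrib, Finset.sum_const, nsmul_eq_mul]
    have h3 : F.card * (1 / x) ≤ C * x := by
      calc F.card * (1 / x) ≤ C * x ^ 2 * (1 / x) := by gcongr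
        _ = C * x := by field_simp
    have h4 : F.card * (2 * η) ≤ 2 * C := by
      calc F.card * (2 * η) ≤ C * x ^ 2 * (2 * η) := by gcongr
        _ = 2 * C := by rw [hη]; field_simp
    linarith
  obtain ⟨s, hcard, hcov⟩ := exists_cover_image_unitBall hposop hON hdense heig hlampos hε0 hη0 hη1
    hF g l (fun j => le_mul_of_one_le_right hε0.le (Real.one_le_exp (by positivity)))
    (fun n hn => by
      have h1 : Real.log (lam n / ε) ≤ (g n + 1) / x := by
        rw [le_div_iff₀ hx0, mul_comm]
        exact (Nat.lt_floor_add_one _).le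
      have h2 := (Real.log_le_iff_le_exp (div_pos (hlampos n) hε0)).1 h1
      rwa [div_le_iff₀ hε0, mul_comm] at h2)
    (L := L) (by positivity)
    (by
      rw [hη, one_div, inv_mul_eq_div, le_div_iff₀ (by positivity)]
      exact hLge) le_rfl
  rw [show (1 + η) ^ 2 * ε = e by rw [hε]; field_simp] at hcov
  refine ⟨s, hcov, ?_⟩
  have hspos : (0 : ℝ) < s.card := by
    obtain ⟨z, hz, -⟩ := hcov 0 (subset_closure ⟨0, by simp, by simp⟩)
    exact_mod_cast Finset.card_pos.2 ⟨z, hz⟩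
  set Q := (L + 1) * (2 * Real.exp 1 * F.card * (F.card * Real.log (3 / η) + S) + 2) with hQ
  have hlogη : 0 ≤ Real.log (3 / η) := Real.log_nonneg ((one_le_div hη0).2 (by linarith))
  have hlogηE : Real.log (3 / η) ≤ 3 * E := by
    have h1 := Real.log_le_sub_one_of_pos (show 0 < 3 / η by positivity)
    have h2 : 3 / η = 3 * x ^ 2 := by rw [hη]; field_simp
    rw [h2] at h1 ⊢
    linarith
  have hQ0 : 0 < Q := by positivity
  have hE0 : 0 < E := by linarith
  have hQE : Q ≤ E ^ 6 := by
    refine polynomial_factor_le_pow_six hE (hLle.trans ?_) hk0 (hFC.trans hCE)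
      hlogη hlogηE hS0 hSE
    have : (J : ℝ) * x ^ 2 ≤ E * E :=
      mul_le_mul (hJle.trans hxtE) hxE (sq_nonneg x) hE0.le
    linarith
  have hlogE : 0 ≤ Real.log E := Real.log_nonneg (by linarith)
  have hfinal := Real.log_le_log hspos hcard
  rw [Real.log_mul (Real.exp_pos _).ne' (by positivity), Real.log_exp, Real.log_pow] at hfinal
  have hlogQ : Real.log Q ≤ 6 * Real.log E := by
    have := Real.log_le_log hQ0 hQE
    rw [Real.log_pow] at this
    exact_mod_cast this
  have hJQ : J * Real.log Q ≤ 3 * x * t * (6 * Real.log E) := by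
    calc J * Real.log Q ≤ J * (6 * Real.log E) := by gcongr
      _ ≤ _ := by gcongr
  linarith

end OperatorUpper

section CountingFunction

variable {lam : ℕ → ℝ} {κ₁ κ₂ β₁ β₂ : ℝ}

/-- The leading term of the two-term asymptotics controls the counting function. -/
theorem eventually_natCard_pos_and_le (hκ₁ : 0 < κ₁)
    (hcase : β₂ < β₁ ∨ (β₁ = β₂ ∧ κ₂ = 0))
    (hasymp : (fun γ : ℝ => (Nat.card {n : ℕ | γ ≤ lam n} : ℝ)
        - κ₁ * γ ^ (-β₁) - κ₂ * γ ^ (-β₂)) =o[𝓝[>] 0] fun γ : ℝ => γ ^ (-β₂)) :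
    ∀ᶠ γ : ℝ in 𝓝[>] 0, 0 < Nat.card {n : ℕ | γ ≤ lam n} ∧
      (Nat.card {n : ℕ | γ ≤ lam n} : ℝ) ≤ 2 * κ₁ * γ ^ (-β₁) := by
  have hlead : ∀ᶠ γ : ℝ in 𝓝[>] 0, |(Nat.card {n : ℕ | γ ≤ lam n} : ℝ) - κ₁ * γ ^ (-β₁)|
      ≤ κ₁ / 2 * γ ^ (-β₁) := by
    rcases hcase with h | ⟨rfl, rfl⟩
    · have h0 : Tendsto (fun γ : ℝ => γ ^ (β₁ - β₂)) (𝓝[>] 0) (𝓝 0) := by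
        have : ContinuousAt (fun γ : ℝ => γ ^ (β₁ - β₂)) 0 :=
          Real.continuousAt_rpow_const _ _ (Or.inr (by linarith))
        have h1 := this.tendsto
        rw [Real.zero_rpow (by linarith)] at h1
        exact h1.mono_left nhdsWithin_le_nhds
      have hc : 0 < κ₁ / 2 / (|κ₂| + 1) := by positivity
      filter_upwards [hasymp.bound one_pos, h0.eventually_le_const hc, self_mem_nhdsWithin]
        with γ h1 h2 (hγ : 0 < γ)
      rw [Real.norm_eq_abs, Real.norm_eq_abs, abs_of_pos (Real.rpow_pos_of_pos hγ _), one_mul] at h1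
      have h3 : γ ^ (-β₂) = γ ^ (β₁ - β₂) * γ ^ (-β₁) := by
        rw [← Real.rpow_add hγ]; ring_nf
      have h4 : |κ₂ * γ ^ (-β₂)| = |κ₂| * γ ^ (-β₂) := by
        rw [abs_mul, abs_of_pos (Real.rpow_pos_of_pos hγ (-β₂))]
      have h5 : (|κ₂| + 1) * γ ^ (-β₂) ≤ κ₁ / 2 * γ ^ (-β₁) := by
        rw [h3, ← mul_assoc]
        refine mul_le_mul_of_nonneg_right ?_ (Real.rpow_pos_of_pos hγ _).le
        rw [le_div_iff₀ (by positivity)] at h2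
        linarith
      have h6 := abs_add_le ((Nat.card {n : ℕ | γ ≤ lam n} : ℝ) - κ₁ * γ ^ (-β₁)
        - κ₂ * γ ^ (-β₂)) (κ₂ * γ ^ (-β₂))
      rw [sub_add_cancel] at h6
      linarith
    · filter_upwards [hasymp.bound (show 0 < κ₁ / 2 by positivity), self_mem_nhdsWithin]
        with γ h1 (hγ : 0 < γ)
      rwa [Real.norm_eq_abs, Real.norm_eq_abs, abs_of_pos (Real.rpow_pos_of_pos hγ _),
        zero_mul, sub_zero] at h1
  filter_upwards [hlead, self_mem_nhdsWithin] with γ h (hγ : 0 < γ)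
  have h1 := Real.rpow_pos_of_pos hγ (-β₁)
  rw [abs_le] at h
  have h2 : 0 < κ₁ * γ ^ (-β₁) := by positivity
  refine ⟨?_, by linarith⟩
  have : (0 : ℝ) < Nat.card {n : ℕ | γ ≤ lam n} := by linarith
  exact_mod_cast this

theorem finite_setOf_le_of_eventually_natCard_pos
    (h : ∀ᶠ γ : ℝ in 𝓝[>] 0, 0 < Nat.card {n : ℕ | γ ≤ lam n}) (e : ℝ) (he : 0 < e) :
    {n | e ≤ lam n}.Finite := by
  have h2 : ∀ᶠ γ : ℝ in 𝓝[>] 0, γ ∈ Set.Ioo 0 e := Ioo_mem_nhdsGT he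
  obtain ⟨γ, h3, -, h4⟩ := (h.and h2).exists
  have : {n : ℕ | γ ≤ lam n}.Finite := Set.finite_of_ncard_pos h3
  exact this.subset fun n hn => h4.le.trans hn

theorem exists_forall_le_of_finite_setOf (hfin : ∀ e > 0, {n | e ≤ lam n}.Finite) :
    ∃ Λ : ℝ, 1 ≤ Λ ∧ ∀ n, lam n ≤ Λ := by
  obtain ⟨Λ, hΛ⟩ := ((hfin 1 one_pos).image lam).bddAbove
  refine ⟨max 1 Λ, le_max_left _ _, fun n => ?_⟩
  rcases le_total 1 (lam n) with h | h
  · exact (hΛ ⟨n, h, rfl⟩).trans (le_max_right _ _)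
  · exact h.trans (le_max_left _ _)

end CountingFunction

/-- Upper bound for the size of optimal covers of the image of the unit ball. -/
theorem eventually_exists_cover_log_card_le {H : Type*} [NormedAddCommGroup H]
    [InnerProductSpace ℝ H] [CompleteSpace H] {T : H →L[ℝ] H}
    (hposop : T.IsPositive) {ψ : ℕ → H} (hON : Orthonormal ℝ ψ)
    (hdense : (Submodule.span ℝ (Set.range ψ)).topologicalClosure = ⊤) {lam : ℕ → ℝ}
    (heig : ∀ n, T (ψ n) = lam n • ψ n) (hlampos : ∀ n, 0 < lam n)
    (hfin : ∀ e > 0, {n | e ≤ lam n}.Finite) {κ₁ β₁ β₂ : ℝ} (hκ₁ : 0 < κ₁) (hβ₁ : 0 < β₁)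
    (hβ : β₁ / 2 < β₂)
    (hcard : ∀ᶠ γ : ℝ in 𝓝[>] 0, (Nat.card {n : ℕ | γ ≤ lam n} : ℝ) ≤ 2 * κ₁ * γ ^ (-β₁))
    {c : ℝ} (hc : 0 < c) :
    ∀ᶠ e : ℝ in 𝓝[>] 0, ∀ Fe : Finset ℕ, (∀ n, n ∈ Fe ↔ e ≤ lam n) → ∃ s : Finset H,
      (∀ y ∈ closure (T '' Metric.closedBall 0 1), ∃ z ∈ s, dist y z ≤ e) ∧
      Real.log s.card ≤ ∑ n ∈ Fe, Real.log (lam n / e) + c * e ^ (-β₂) := by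
  obtain ⟨Λ, hΛ1, hΛ⟩ := exists_forall_le_of_finite_setOf hfin
  set C := 2 * κ₁ * 4 ^ β₁ with hC
  have hC0 : 0 < C := by positivity
  set N := β₁ + 1 with hN
  rw [eventually_nhdsWithin_iff, Metric.eventually_nhds_iff] at hcard
  obtain ⟨r, hr, hcard⟩ := hcard
  have hlogo := (isLittleO_abs_log_rpow_rpow_nhdsGT_zero (s := -(β₂ - β₁ / 2)) 2
    (by linarith)).bound (show 0 < c / (3 * C + 18 * N) by positivity)
  have hlogo' := (isLittleO_abs_log_rpow_rpow_nhdsGT_zero (s := -1) 1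
    (by linarith)).bound (show (0 : ℝ) < 1 / 3 by positivity)
  have hev : ∀ᶠ e : ℝ in 𝓝[>] 0, e ∈ Set.Ioo 0 (min (min r 1) (1 / (4 * Λ) * Real.exp (-1))) :=
    Ioo_mem_nhdsGT (by positivity)
  filter_upwards [hlogo, hlogo', hev, eventually_le_rpow_neg one_pos (max C 104)]
    with e h2 h1 ⟨he, heb⟩ hbig Fe hFe
  obtain ⟨⟨her, he1⟩, heΛ⟩ : (e < r ∧ e < 1) ∧ e < 1 / (4 * Λ) * Real.exp (-1) := by
    simpa only [lt_min_iff] using heb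
  set t := -Real.log e with ht
  set x := e ^ (-(β₁ / 2)) with hx
  have hx1 : 1 ≤ x := Real.one_le_rpow_of_pos_of_le_one_of_nonpos he he1.le (by linarith)
  have hx2 : x ^ 2 = e ^ (-β₁) := by
    rw [hx, ← Real.rpow_natCast, ← Real.rpow_mul he.le]; norm_num
  have hx21 : 1 ≤ x ^ 2 := one_le_pow₀ hx1
  have hΛ0 : 0 < Λ := by linarith
  have htΛ : Real.log (4 * Λ) + 1 ≤ t := by
    have := Real.log_lt_log he heΛ
    rw [Real.log_mul (by positivity) (Real.exp_pos _).ne', Real.log_exp, one_div,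
      Real.log_inv] at this
    linarith
  have ht1 : 1 ≤ t := by
    have := Real.log_nonneg (show 1 ≤ 4 * Λ by linarith)
    linarith
  have habs : |Real.log e| = t := by
    rw [abs_of_nonpos (by linarith)]
  have hp1 := Real.rpow_pos_of_pos he (-1)
  rw [habs, Real.rpow_one, Real.norm_eq_abs, Real.norm_eq_abs, abs_of_pos hp1,
    abs_of_pos (by linarith)] at h1
  rw [habs, Real.norm_eq_abs, Real.norm_eq_abs, abs_of_pos (Real.rpow_pos_of_pos he _),
    abs_of_pos (by positivity), Real.rpow_two] at h2
  have hE : e ^ (-N) = x ^ 2 * e ^ (-1 : ℝ) := by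
    rw [hx2, ← Real.rpow_add he, hN]; ring_nf
  set η := 1 / x ^ 2 with hη
  have hη0 : 0 < η := by positivity
  have hη1 : η ≤ 1 := by
    rwa [hη, div_le_one (by positivity)]
  set ε := e / (1 + η) ^ 2 with hε
  have hε0 : 0 < ε := by positivity
  have hεe : ε ≤ e := div_le_self he.le (one_le_pow₀ (by linarith))
  have heε : e / 4 ≤ ε := by
    refine div_le_div_of_nonneg_left he.le (by positivity) ?_
    calc (1 + η) ^ 2 ≤ (1 + 1) ^ 2 := by gcongr
      _ = 4 := by norm_num
  have hE104 : 104 ≤ e ^ (-N) := by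
    rw [hE]
    exact ((le_max_right _ _).trans hbig).trans (le_mul_of_one_le_left hp1.le hx21)
  have hF : ∀ n, n ∈ (hfin ε hε0).toFinset ↔ e / (1 + η) ^ 2 ≤ lam n := by
    intro n
    simp only [Set.Finite.mem_toFinset, Set.mem_ofPred_eq, hε]
  have hFC : ((hfin ε hε0).toFinset.card : ℝ) ≤ C * x ^ 2 := by
    have h3 := hcard (y := ε) (by rw [Real.dist_eq, sub_zero, abs_of_pos hε0]; linarith) hε0
    rw [Nat.card_coe_set_eq, Set.ncard_eq_toFinset_card _ (hfin ε hε0)] at h3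
    refine h3.trans ?_
    rw [hC, hx2, mul_assoc (2 * κ₁)]
    refine mul_le_mul_of_nonneg_left ?_ (by positivity)
    calc ε ^ (-β₁) ≤ (e / 4) ^ (-β₁) :=
          Real.rpow_le_rpow_of_nonpos (by positivity) heε (by linarith)
      _ = 4 ^ β₁ * e ^ (-β₁) := by
          rw [Real.div_rpow he.le (by norm_num), Real.rpow_neg (by norm_num : (0 : ℝ) ≤ 4),
            div_inv_eq_mul, mul_comm]
  have hFt : ∀ n ∈ (hfin ε hε0).toFinset, Real.log (lam n / (e / (1 + η) ^ 2)) ≤ 2 * t := by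
    intro n _
    have h3 : lam n / ε ≤ 4 * Λ / e := by
      calc lam n / ε ≤ Λ / (e / 4) := by gcongr; exact hΛ n
        _ = _ := by field_simp
    have h4 := Real.log_le_log (div_pos (hlampos n) hε0) h3
    rw [Real.log_div (by positivity) he.ne'] at h4
    rw [← hε]
    linarith
  have hCE : C * x ^ 2 ≤ e ^ (-N) := by
    rw [hE, mul_comm]
    exact mul_le_mul_of_nonneg_left ((le_max_left _ _).trans hbig) (sq_nonneg x)
  have hxtE : 3 * x * t ≤ e ^ (-N) := by
    rw [hE, show 3 * x * t = x * (3 * t) by ring]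
    exact mul_le_mul (by nlinarith) (by linarith) (by positivity) (sq_nonneg x)
  have hxE : x ^ 2 ≤ e ^ (-N) := by
    rw [hE]
    exact le_mul_of_one_le_right (sq_nonneg x)
      (((by norm_num : (1 : ℝ) ≤ 104).trans (le_max_right C 104)).trans hbig)
  obtain ⟨s, hs, hslog⟩ := exists_cover_image_unitBall_log_card_le hposop hON hdense heig hlampos
    he hx1 hη ht1 hE104 hF hFe hFC hFt hCE hxtE hxE
  refine ⟨s, hs, hslog.trans ?_⟩
  have hlogE : Real.log (e ^ (-N)) = N * t := by
    rw [Real.log_rpow he, ht]; ring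
  have hβ₂ : e ^ (-β₂) = x * e ^ (-(β₂ - β₁ / 2)) := by
    rw [hx, ← Real.rpow_add he]; ring_nf
  rw [hlogE, hβ₂]
  have h3 : (3 * C + 18 * N) * t ^ 2 ≤ c * e ^ (-(β₂ - β₁ / 2)) := by
    rw [div_mul_eq_mul_div, le_div_iff₀ (by positivity)] at h2
    linarith
  have h4 : 2 * C + C * x ≤ 3 * C * x * t ^ 2 := by
    have h5 : 1 ≤ t ^ 2 := one_le_pow₀ ht1
    have h6 : 2 * C + C * x ≤ 3 * C * x := by
      linarith [le_mul_of_one_le_right hC0.le hx1]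
    exact h6.trans (le_mul_of_one_le_right (by positivity) h5)
  have h7 := mul_le_mul_of_nonneg_left h3 (show 0 ≤ x by linarith)
  linarith

section Inversion

variable {κ₁ β₁ β₂ A : ℝ}

theorem two_term_eq_mul {x b : ℝ} (hx : 0 < x) (hβ₁ : 0 < β₁) :
    A * x ^ (-(1 / β₁)) + b * x ^ (-((1 + β₁ - β₂) / β₁))
      = x ^ (-(1 / β₁)) * (A + b * x ^ (-(1 - β₂ / β₁))) := by
  have : x ^ (-((1 + β₁ - β₂) / β₁)) = x ^ (-(1 / β₁)) * x ^ (-(1 - β₂ / β₁)) := by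
    rw [← Real.rpow_add hx]
    congr 1
    field_simp
    ring
  rw [this]
  ring

theorem two_term_rpow_neg {x b : ℝ} (hx : 0 < x) (hβ₁ : 0 < β₁)
    (h : 0 < A + b * x ^ (-(1 - β₂ / β₁))) (β : ℝ) :
    (A * x ^ (-(1 / β₁)) + b * x ^ (-((1 + β₁ - β₂) / β₁))) ^ (-β)
      = x ^ (β / β₁) * (A + b * x ^ (-(1 - β₂ / β₁))) ^ (-β) := by
  rw [two_term_eq_mul hx hβ₁, Real.mul_rpow (Real.rpow_pos_of_pos hx _).le h.le,
    ← Real.rpow_mul hx.le]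
  congr 2
  field_simp

theorem tendsto_natCast_rpow_neg_zero {r : ℝ} (hr : 0 < r) :
    Tendsto (fun m : ℕ => (m : ℝ) ^ (-r)) atTop (𝓝 0) :=
  (tendsto_rpow_neg_atTop hr).comp tendsto_natCast_atTop_atTop

theorem tendsto_two_term_of_lt (hβ₁ : 0 < β₁) (hβ : β₂ < β₁) (hA : 0 < A) (b k : ℝ) :
    Tendsto (fun m : ℕ =>
      (κ₁ / β₁ * (A * (m : ℝ) ^ (-(1 / β₁)) + b * (m : ℝ) ^ (-((1 + β₁ - β₂) / β₁))) ^ (-β₁)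
        + k * (A * (m : ℝ) ^ (-(1 / β₁)) + b * (m : ℝ) ^ (-((1 + β₁ - β₂) / β₁))) ^ (-β₂)
        - m * (κ₁ / β₁ * A ^ (-β₁))) / (m : ℝ) ^ (β₂ / β₁)) atTop
      (𝓝 (-(κ₁ * A ^ (-β₁ - 1)) * b + k * A ^ (-β₂))) := by
  have hq : 0 < 1 - β₂ / β₁ := by rw [sub_pos, div_lt_one hβ₁]; exact hβ
  have hv := tendsto_natCast_rpow_neg_zero hq
  have hvne : Tendsto (fun m : ℕ => (m : ℝ) ^ (-(1 - β₂ / β₁))) atTop (𝓝[≠] 0) := by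
    refine tendsto_nhdsWithin_iff.2 ⟨hv, ?_⟩
    filter_upwards [eventually_gt_atTop 0] with m hm
    exact (Real.rpow_pos_of_pos (by exact_mod_cast hm) _).ne'
  have hbase : HasDerivAt (fun v : ℝ => A + b * v) b 0 := by
    simpa using ((hasDerivAt_id (0 : ℝ)).const_mul b).const_add A
  have hderiv : HasDerivAt (fun v : ℝ => κ₁ / β₁ * (A + b * v) ^ (-β₁))
      (-(κ₁ * A ^ (-β₁ - 1)) * b) 0 := by
    have h := (hbase.rpow_const (p := -β₁) (Or.inl (by simpa using hA.ne'))).const_mul (κ₁ / β₁)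
    refine h.congr_deriv ?_
    rw [mul_zero, add_zero]
    field_simp
  have hslope := hderiv.tendsto_slope_zero.comp hvne
  have hbaselim : Tendsto (fun m : ℕ => A + b * (m : ℝ) ^ (-(1 - β₂ / β₁))) atTop (𝓝 A) := by
    simpa using (hv.const_mul b).const_add A
  have hsecond := (hbaselim.rpow_const (p := -β₂) (Or.inl hA.ne')).const_mul k
  refine (hslope.add hsecond).congr' ?_
  filter_upwards [eventually_gt_atTop 0, hbaselim.eventually_const_lt hA] with m hm hpos
  have hm0 : (0 : ℝ) < m := by exact_mod_cast hm
  have hp := Real.rpow_pos_of_pos hm0 (β₂ / β₁)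
  rw [two_term_rpow_neg hm0 hβ₁ hpos, two_term_rpow_neg hm0 hβ₁ hpos, div_self hβ₁.ne',
    Real.rpow_one]
  simp only [Function.comp_apply, zero_add, mul_zero, add_zero, smul_eq_mul]
  have hinv : ((m : ℝ) ^ (-(1 - β₂ / β₁)))⁻¹ = m / (m : ℝ) ^ (β₂ / β₁) := by
    rw [Real.rpow_neg hm0.le, inv_inv, Real.rpow_sub hm0, Real.rpow_one]
  rw [hinv]
  field_simp
  ring

theorem tendsto_two_term_of_eq (hβ₁ : 0 < β₁) {b : ℝ} (hb : 0 < A + b) (k : ℝ) :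
    Tendsto (fun m : ℕ =>
      (κ₁ / β₁ * (A * (m : ℝ) ^ (-(1 / β₁)) + b * (m : ℝ) ^ (-((1 + β₁ - β₁) / β₁))) ^ (-β₁)
        + k * (A * (m : ℝ) ^ (-(1 / β₁)) + b * (m : ℝ) ^ (-((1 + β₁ - β₁) / β₁))) ^ (-β₁)
        - m * (κ₁ / β₁ * A ^ (-β₁))) / (m : ℝ) ^ (β₁ / β₁)) atTop
      (𝓝 ((κ₁ / β₁ * (A + b) ^ (-β₁) - κ₁ / β₁ * A ^ (-β₁)) + k * (A + b) ^ (-β₁))) := by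
  refine tendsto_const_nhds.congr' ?_
  filter_upwards [eventually_gt_atTop 0] with m hm
  have hm0 : (0 : ℝ) < m := by exact_mod_cast hm
  have hone : A + b * (m : ℝ) ^ (-(1 - β₁ / β₁)) = A + b := by
    rw [div_self hβ₁.ne']; simp
  rw [two_term_rpow_neg hm0 hβ₁ (by rwa [hone]), hone, div_self hβ₁.ne', Real.rpow_one]
  field_simp
  ring

/-- Sign of the defect of the two-term ansatz, perturbed above and below. -/
theorem exists_pos_eventually_two_term {κ₂ : ℝ} (hκ₁ : 0 < κ₁) (hβ₁ : 0 < β₁)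
    (hcase : β₂ < β₁ ∨ (β₁ = β₂ ∧ κ₂ = 0)) (hA : 0 < A) {B δ : ℝ} (hδ : 0 < δ) (hδA : δ < A)
    (hB : κ₁ * A ^ (-β₁ - 1) * B = κ₂ / β₂ * A ^ (-β₂)) :
    ∃ c > 0, ∀ᶠ m : ℕ in atTop, ∀ x y : ℝ,
      x = A * (m : ℝ) ^ (-(1 / β₁)) + (B + δ) * (m : ℝ) ^ (-((1 + β₁ - β₂) / β₁)) →
      y = A * (m : ℝ) ^ (-(1 / β₁)) + (B - δ) * (m : ℝ) ^ (-((1 + β₁ - β₂) / β₁)) →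
      κ₁ / β₁ * x ^ (-β₁) + κ₂ / β₂ * x ^ (-β₂) + c * x ^ (-β₂) < m * (κ₁ / β₁ * A ^ (-β₁)) ∧
      m * (κ₁ / β₁ * A ^ (-β₁)) < κ₁ / β₁ * y ^ (-β₁) + κ₂ / β₂ * y ^ (-β₂) - c * y ^ (-β₂) := by
  have key : ∀ d : ℝ, (d = δ ∨ d = -δ) → ∃ u v : ℝ, 0 < v ∧ u * d < 0 ∧ ∀ k, Tendsto (fun m : ℕ =>
      (κ₁ / β₁ * (A * (m : ℝ) ^ (-(1 / β₁)) + (B + d) * (m : ℝ) ^ (-((1 + β₁ - β₂) / β₁))) ^ (-β₁)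
        + (κ₂ / β₂ + k)
          * (A * (m : ℝ) ^ (-(1 / β₁)) + (B + d) * (m : ℝ) ^ (-((1 + β₁ - β₂) / β₁))) ^ (-β₂)
        - m * (κ₁ / β₁ * A ^ (-β₁))) / (m : ℝ) ^ (β₂ / β₁)) atTop (𝓝 (u + k * v)) := by
    intro d hd
    rcases hcase with h | ⟨rfl, rfl⟩
    · refine ⟨-(κ₁ * A ^ (-β₁ - 1)) * d, A ^ (-β₂), by positivity, ?_, fun k => ?_⟩
      · have : 0 < κ₁ * A ^ (-β₁ - 1) * (d * d) := by
          rcases hd with rfl | rfl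
          · positivity
          · rw [neg_mul_neg]; positivity
        linarith
      · convert tendsto_two_term_of_lt (κ₁ := κ₁) hβ₁ h hA (B + d) (κ₂ / β₂ + k) using 2
        linarith
    · have hB0 : B = 0 := by
        rw [zero_div, zero_mul] at hB
        exact (mul_eq_zero.1 hB).resolve_left (by positivity)
      subst hB0
      have hpos : 0 < A + d := by rcases hd with rfl | rfl <;> linarith
      refine ⟨κ₁ / β₁ * (A + d) ^ (-β₁) - κ₁ / β₁ * A ^ (-β₁), (A + d) ^ (-β₁), by positivity, ?_,
        fun k => ?_⟩
      · rw [← mul_sub]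
        have hκ : 0 < κ₁ / β₁ := by positivity
        rcases hd with rfl | rfl
        · have := Real.rpow_lt_rpow_of_neg hA (show A < A + d by linarith)
            (show -β₁ < 0 by linarith)
          exact mul_neg_of_neg_of_pos (mul_neg_of_pos_of_neg hκ (by linarith)) hδ
        · have := Real.rpow_lt_rpow_of_neg hpos (show A + -δ < A by linarith)
            (show -β₁ < 0 by linarith)
          exact mul_neg_of_pos_of_neg (mul_pos hκ (by linarith)) (by linarith)
      · simpa only [zero_add, zero_div] using tendsto_two_term_of_eq (κ₁ := κ₁) hβ₁ hpos k
  obtain ⟨u, v, hv, hu, hlim⟩ := key δ (Or.inl rfl)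
  obtain ⟨u', v', hv', hu', hlim'⟩ := key (-δ) (Or.inr rfl)
  have hu0 : u < 0 := by nlinarith
  have hu0' : 0 < u' := by nlinarith
  refine ⟨min (-u / (2 * v)) (u' / (2 * v')), lt_min (div_pos (by linarith) (by positivity))
    (by positivity), ?_⟩
  set c := min (-u / (2 * v)) (u' / (2 * v')) with hc
  have h1 : u + c * v < 0 := by
    have : c ≤ -u / (2 * v) := min_le_left _ _
    rw [le_div_iff₀ (by positivity)] at this
    linarith
  have h2 : 0 < u' + -c * v' := by
    have : c ≤ u' / (2 * v') := min_le_right _ _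
    rw [le_div_iff₀ (by positivity)] at this
    linarith
  filter_upwards [(hlim c).eventually_lt_const h1, (hlim' (-c)).eventually_const_lt h2,
    eventually_gt_atTop 0] with m e1 e2 hm x y hx hy
  have hp := Real.rpow_pos_of_pos (show (0 : ℝ) < m by exact_mod_cast hm) (β₂ / β₁)
  rw [← hx, div_neg_iff] at e1
  rw [← sub_eq_add_neg B δ, ← hy, div_pos_iff] at e2
  constructor
  · rcases e1 with e1 | e1 <;> linarith
  · rcases e2 with e2 | e2 <;> linarith

end Inversion

section CoveringNumber

variable {X : Type*} [PseudoMetricSpace X] {K : Set X} {ε : ℝ}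

theorem coveringNumber_le_card {s : Finset X} (hs : ∀ x ∈ K, ∃ y ∈ s, dist x y ≤ ε) :
    coveringNumber ε K ≤ s.card :=
  Nat.sInf_le ⟨s, rfl, hs⟩

theorem exists_cover_card_eq_coveringNumber {s : Finset X}
    (hs : ∀ x ∈ K, ∃ y ∈ s, dist x y ≤ ε) :
    ∃ s : Finset X, s.card = coveringNumber ε K ∧ ∀ x ∈ K, ∃ y ∈ s, dist x y ≤ ε :=
  Nat.sInf_mem (s := {n : ℕ | ∃ s : Finset X, s.card = n ∧ ∀ x ∈ K, ∃ y ∈ s, dist x y ≤ ε})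
    ⟨_, s, rfl, hs⟩

theorem log_natCast_le_log_natCast {a b : ℕ} (h : a ≤ b) : Real.log a ≤ Real.log b := by
  rcases Nat.eq_zero_or_pos a with rfl | ha
  · simpa using Real.log_natCast_nonneg b
  · exact Real.log_le_log (by exact_mod_cast ha) (by exact_mod_cast h)

theorem metricEntropy_mul_log_two (ε : ℝ) (K : Set X) :
    metricEntropy ε K * Real.log 2 = Real.log (coveringNumber ε K) := by
  rw [metricEntropy, Real.logb, div_mul_cancel₀ _ (Real.log_pos one_lt_two).ne']

theorem metricEntropy_anti {s : Finset X} (hs : ∀ x ∈ K, ∃ y ∈ s, dist x y ≤ ε) {ε' : ℝ}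
    (h : ε ≤ ε') : metricEntropy ε' K ≤ metricEntropy ε K := by
  obtain ⟨t, ht, hcov⟩ := exists_cover_card_eq_coveringNumber hs
  have h1 : coveringNumber ε' K ≤ coveringNumber ε K := by
    rw [← ht]
    refine coveringNumber_le_card fun x hx => ?_
    obtain ⟨y, hy, hxy⟩ := hcov x hx
    exact ⟨y, hy, hxy.trans h⟩
  refine le_of_mul_le_mul_right ?_ (Real.log_pos one_lt_two)
  rw [metricEntropy_mul_log_two, metricEntropy_mul_log_two]
  exact log_natCast_le_log_natCast h1

end CoveringNumber

/-- Inversion: two-term asymptotics of a function that is antitone near zero yield two-term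
asymptotics of its generalized inverse along the integers. -/
theorem isLittleO_sInf_sub_two_term {h : ℝ → ℝ} {κ₁ κ₂ β₁ β₂ : ℝ} (hκ₁ : 0 < κ₁) (hβ₁ : 0 < β₁)
    (hcase : β₂ < β₁ ∨ (β₁ = β₂ ∧ κ₂ = 0))
    (hanti : ∀ᶠ e : ℝ in 𝓝[>] 0, ∀ e', e ≤ e' → h e' ≤ h e)
    (hasymp : ∀ c > 0, ∀ᶠ e : ℝ in 𝓝[>] 0,
      |h e * Real.log 2 - (κ₁ / β₁ * e ^ (-β₁) + κ₂ / β₂ * e ^ (-β₂))| ≤ c * e ^ (-β₂))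
    {A B : ℝ} (hA : 0 < A) (hA2 : κ₁ / β₁ * A ^ (-β₁) = Real.log 2)
    (hB : κ₁ * A ^ (-β₁ - 1) * B = κ₂ / β₂ * A ^ (-β₂)) :
    (fun m : ℕ => sInf {ε : ℝ | 0 < ε ∧ h ε ≤ m} - A * (m : ℝ) ^ (-(1 / β₁))
        - B * (m : ℝ) ^ (-((1 + β₁ - β₂) / β₁)))
      =o[atTop] fun m : ℕ => (m : ℝ) ^ (-((1 + β₁ - β₂) / β₁)) := by
  have hlog2 : 0 < Real.log 2 := Real.log_pos one_lt_two
  have hβ : β₂ ≤ β₁ := by rcases hcase with h | h <;> linarith [h]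
  refine isLittleO_iff.2 fun {δ₀} hδ₀ => ?_
  set δ := min δ₀ (A / 2) with hδ
  have hδ0 : 0 < δ := lt_min hδ₀ (by positivity)
  have hδA : δ < A := (min_le_right _ _).trans_lt (by linarith)
  obtain ⟨c, hc, hev⟩ := exists_pos_eventually_two_term (β₂ := β₂) hκ₁ hβ₁ hcase hA hδ0 hδA hB
  have hsmall : ∀ b : ℝ, (b = B + δ ∨ b = B - δ) → Tendsto (fun m : ℕ =>
      A * (m : ℝ) ^ (-(1 / β₁)) + b * (m : ℝ) ^ (-((1 + β₁ - β₂) / β₁))) atTop (𝓝[>] 0) := by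
    intro b hb
    refine tendsto_nhdsWithin_iff.2 ⟨?_, ?_⟩
    · have h1 := (tendsto_natCast_rpow_neg_zero (r := 1 / β₁) (by positivity)).const_mul A
      have h2 := (tendsto_natCast_rpow_neg_zero (r := (1 + β₁ - β₂) / β₁)
        (div_pos (by linarith) hβ₁)).const_mul b
      simpa using h1.add h2
    · have hfac : ∀ᶠ m : ℕ in atTop, 0 < A + b * (m : ℝ) ^ (-(1 - β₂ / β₁)) := by
        rcases hcase with hlt | ⟨rfl, rfl⟩
        · have hq : 0 < 1 - β₂ / β₁ := by rw [sub_pos, div_lt_one hβ₁]; exact hlt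
          have := ((tendsto_natCast_rpow_neg_zero hq).const_mul b).const_add A
          rw [mul_zero, add_zero] at this
          exact this.eventually_const_lt hA
        · have hB0 : B = 0 := by
            rw [zero_div, zero_mul] at hB
            exact (mul_eq_zero.1 hB).resolve_left (by positivity)
          refine Eventually.of_forall fun m => ?_
          rw [div_self hβ₁.ne', sub_self, neg_zero, Real.rpow_zero, mul_one]
          rcases hb with rfl | rfl <;> linarith
      filter_upwards [hfac, eventually_gt_atTop 0] with m h1 hm
      have hm0 : (0 : ℝ) < m := by exact_mod_cast hm
      rw [two_term_eq_mul hm0 hβ₁]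
      exact mul_pos (Real.rpow_pos_of_pos hm0 _) h1
  have hgood := (hasymp c hc).and (hanti.and self_mem_nhdsWithin)
  have hanti' := hanti
  rw [eventually_nhdsWithin_iff, Metric.eventually_nhds_iff] at hanti'
  obtain ⟨r, hr, hanti'⟩ := hanti'
  filter_upwards [hev, (hsmall _ (Or.inl rfl)).eventually hgood,
    (hsmall _ (Or.inr rfl)).eventually hgood,
    (hsmall _ (Or.inr rfl)).eventually (Ioo_mem_nhdsGT hr : ∀ᶠ e : ℝ in 𝓝[>] 0, e ∈ Set.Ioo 0 r),
    eventually_gt_atTop 0] with m hm hx hy hyr hm0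
  set p := (m : ℝ) ^ (-((1 + β₁ - β₂) / β₁)) with hp
  set w := A * (m : ℝ) ^ (-(1 / β₁)) with hw
  have hp0 : 0 < p := Real.rpow_pos_of_pos (by exact_mod_cast hm0) _
  obtain ⟨hmx, hmy⟩ := hm _ _ rfl rfl
  rw [hA2] at hmx hmy
  obtain ⟨hx1, -, hx0⟩ := hx
  obtain ⟨hy1, -, hy0⟩ := hy
  rw [abs_le] at hx1 hy1
  have hhx : h (w + (B + δ) * p) ≤ m := by
    refine le_of_mul_le_mul_right ?_ hlog2
    linarith [hx1.2]
  have hhy : (m : ℝ) < h (w + (B - δ) * p) := by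
    refine lt_of_mul_lt_mul_right ?_ hlog2.le
    linarith [hy1.1]
  have hupper : sInf {ε : ℝ | 0 < ε ∧ h ε ≤ m} ≤ w + (B + δ) * p :=
    csInf_le ⟨0, fun _ hε => hε.1.le⟩ ⟨hx0, hhx⟩
  have hlower : w + (B - δ) * p ≤ sInf {ε : ℝ | 0 < ε ∧ h ε ≤ m} := by
    refine le_csInf ⟨_, hx0, hhx⟩ fun ε hε => ?_
    by_contra! hlt
    have h1 := hanti' (y := ε) (by
      rw [Real.dist_eq, sub_zero, abs_of_pos hε.1]
      exact hlt.trans hyr.2) hε.1 _ hlt.le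
    linarith [hε.2]
  have hδp : δ * p ≤ δ₀ * p := mul_le_mul_of_nonneg_right (min_le_left _ _) hp0.le
  rw [Real.norm_eq_abs, Real.norm_eq_abs, abs_of_pos hp0, abs_le]
  constructor <;> linarith

theorem entropyNumbers_of_compact_operator_counting_function
    {H : Type*} [NormedAddCommGroup H] [InnerProductSpace ℝ H] [CompleteSpace H]
    [SeparableSpace H]
    (T : H →L[ℝ] H) (hcomp : IsCompactOperator T) (hposop : T.IsPositive)
    -- `ψ` is an orthonormal basis of `H` consisting of eigenvectors of `T`,
    -- with eigenvalues `lam n`, counted with multiplicity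
    (ψ : ℕ → H) (hON : Orthonormal ℝ ψ)
    (hdense : (Submodule.span ℝ (Set.range ψ)).topologicalClosure = ⊤)
    (lam : ℕ → ℝ) (heig : ∀ n, T (ψ n) = lam n • ψ n)
    (hlampos : ∀ n, 0 < lam n)
    (κ₁ κ₂ β₁ β₂ : ℝ) (hκ₁ : 0 < κ₁) (hβ₁ : 0 < β₁) (hβ₂ : 0 < β₂)
    (hcase : (β₁ / 2 < β₂ ∧ β₂ < β₁) ∨ (β₁ = β₂ ∧ κ₂ = 0))
    (hasymp : (fun γ : ℝ => (Nat.card {n : ℕ | γ ≤ lam n} : ℝ)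
        - κ₁ * γ ^ (-β₁) - κ₂ * γ ^ (-β₂))
      =o[𝓝[>] 0] fun γ : ℝ => γ ^ (-β₂))
    (βs : ℝ) (hβs : βs = β₁ / (1 + β₁ - β₂)) :
    (fun m : ℕ => opEntropyNumber m T
        - (κ₁ / (β₁ * Real.log 2)) ^ (1 / β₁) * (m : ℝ) ^ (-(1 / β₁))
        - κ₂ / (κ₁ * β₂) * (κ₁ / (β₁ * Real.log 2)) ^ (1 / βs) * (m : ℝ) ^ (-(1 / βs)))
      =o[atTop] fun m : ℕ => (m : ℝ) ^ (-(1 / βs)) := by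
  have hlog2 : 0 < Real.log 2 := Real.log_pos one_lt_two
  have hlt : β₁ / 2 < β₂ := by
    rcases hcase with h | h
    · exact h.1
    · linarith [h.1]
  have hcase' : β₂ < β₁ ∨ (β₁ = β₂ ∧ κ₂ = 0) := hcase.imp_left And.right
  have hcard := eventually_natCard_pos_and_le hκ₁ hcase' hasymp
  have hfin := finite_setOf_le_of_eventually_natCard_pos (hcard.mono fun _ h => h.1)
  have hcover := fun (c : ℝ) (hc : 0 < c) => eventually_exists_cover_log_card_le hposop hON hdense
    heig hlampos hfin hκ₁ hβ₁ hlt (hcard.mono fun _ h => h.2) hc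
  have hanti : ∀ᶠ e : ℝ in 𝓝[>] 0, ∀ e', e ≤ e' → opEntropy e' T ≤ opEntropy e T := by
    filter_upwards [hcover 1 one_pos, self_mem_nhdsWithin] with e he (he0 : 0 < e) e' hle
    obtain ⟨s, hs, -⟩ := he (hfin e he0).toFinset fun n => by simp
    exact metricEntropy_anti hs hle
  have hentropy : ∀ c > 0, ∀ᶠ e : ℝ in 𝓝[>] 0,
      |opEntropy e T * Real.log 2 - (κ₁ / β₁ * e ^ (-β₁) + κ₂ / β₂ * e ^ (-β₂))|
        ≤ c * e ^ (-β₂) := by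
    intro c hc
    have hc2 : 0 < c / 2 := by positivity
    filter_upwards [hcover _ hc2, eventually_abs_sum_log_sub_le hfin hβ₁ hβ₂ hasymp hc2,
      self_mem_nhdsWithin] with e h1 h2 (he : 0 < e)
    have hF : ∀ n, n ∈ (hfin e he).toFinset ↔ e ≤ lam n := fun n => by simp
    obtain ⟨s, hs, hslog⟩ := h1 _ hF
    obtain ⟨t, ht, hcov⟩ := exists_cover_card_eq_coveringNumber hs
    have hle := log_natCast_le_log_natCast (coveringNumber_le_card hs)
    have hge := sum_log_le_log_card_of_cover hON heig hlampos he (hfin e he).toFinset t hcov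
    rw [ht] at hge
    have h3 := abs_le.1 (h2 _ hF)
    have hpow := mul_pos hc2 (Real.rpow_pos_of_pos he (-β₂))
    rw [opEntropy, metricEntropy_mul_log_two, abs_le]
    constructor <;> linarith [h3.1, h3.2]
  set a := κ₁ / (β₁ * Real.log 2) with ha
  have ha0 : 0 < a := by positivity
  have hA : 0 < a ^ (1 / β₁) := Real.rpow_pos_of_pos ha0 _
  have hβs' : 1 / βs = (1 + β₁ - β₂) / β₁ := by rw [hβs, one_div_div]
  rw [hβs']
  refine isLittleO_sInf_sub_two_term hκ₁ hβ₁ hcase' hanti hentropy hA ?_ ?_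
  · rw [← Real.rpow_mul ha0.le, show 1 / β₁ * -β₁ = -1 by field_simp, Real.rpow_neg_one, ha]
    field_simp
  · rw [← Real.rpow_mul ha0.le, ← Real.rpow_mul ha0.le]
    have : a ^ (1 / β₁ * (-β₁ - 1)) * a ^ ((1 + β₁ - β₂) / β₁) = a ^ (1 / β₁ * -β₂) := by
      rw [← Real.rpow_add ha0]
      congr 1
      field_simp
      ring
    rw [← this]
    field_simp
end
end

section
/- Let T be a positive self-adjoint compact operator on a separable real Hilbert space with eigenvalues {λ_n}_{n≥1} arranged in non-increasing order (counted with multiplicity), and suppose its eigenvalue-counting function satisfies M_T(γ) = κ₁ γ^{-β₁} + κ₂ γ^{-β₂} + o(γ^{-β₂}) as γ → 0, where κ₁ > 0, κ₂ ∈ ℝ, and β₁ ≥ β₂ > 0 (with κ₂ = 0 if β₁ = β₂). Then λ_n = κ₁^{1/β₁} n^{-1/β₁} + (κ₁^{1/β₁ - β₂/β₁} κ₂ / β₁) n^{β₂/β₁ - 1/β₁ - 1} + o(n^{β₂/β₁ - 1/β₁ - 1}) as n → ∞. -/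
open MeasureTheory Filter Asymptotics Topology TopologicalSpace
open scoped BigOperators ENNReal NNReal

noncomputable section

/-- If `M γ = κ₁ γ^{-β₁} + κ₂ γ^{-β₂} + o(γ^{-β₂})` as `γ → 0⁺`, with `κ₁ > 0` the dominant
coefficient, then `M` does not vanish near `0⁺`. -/
theorem eventually_ne_zero_of_isLittleO_rpow {M : ℝ → ℝ} {κ₁ κ₂ β₁ β₂ : ℝ} (hκ₁ : 0 < κ₁)
    (hβ : β₂ ≤ β₁) (hcase : β₁ = β₂ → κ₂ = 0)
    (hM : (fun γ : ℝ => M γ - κ₁ * γ ^ (-β₁) - κ₂ * γ ^ (-β₂)) =o[𝓝[>] 0]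
      fun γ : ℝ => γ ^ (-β₂)) :
    ∀ᶠ γ in 𝓝[>] (0 : ℝ), M γ ≠ 0 := by
  have hsmall : Tendsto (fun γ : ℝ => κ₂ * γ ^ (β₁ - β₂)) (𝓝[>] 0) (𝓝 0) := by
    rcases hβ.eq_or_lt with h | h
    · simp [hcase h.symm]
    · have h0 : 0 < β₁ - β₂ := sub_pos.2 h
      have hc := (Real.continuousAt_rpow_const (0 : ℝ) (β₁ - β₂) (Or.inr h0.le)).tendsto
      rw [Real.zero_rpow h0.ne'] at hc
      simpa using (hc.mono_left nhdsWithin_le_nhds).const_mul κ₂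
  have hpow : ∀ᶠ γ in 𝓝[>] (0 : ℝ), γ ^ (β₁ - β₂) ≤ 1 := by
    filter_upwards [Ioo_mem_nhdsGT (zero_lt_one' ℝ)] with γ hγ
    exact Real.rpow_le_one hγ.1.le hγ.2.le (sub_nonneg.2 hβ)
  filter_upwards [hM.bound (half_pos hκ₁), hpow, self_mem_nhdsWithin,
    (tendsto_order.1 hsmall).1 (-(κ₁ / 2)) (by linarith)] with γ hb hle hγ hgt h0
  have hγ : 0 < γ := hγ
  have hp : 0 < γ ^ (-β₁) := Real.rpow_pos_of_pos hγ _
  have hsplit : γ ^ (-β₂) = γ ^ (β₁ - β₂) * γ ^ (-β₁) := by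
    rw [← Real.rpow_add hγ]; ring_nf
  rw [h0, Real.norm_eq_abs, Real.norm_eq_abs, hsplit,
    abs_of_pos (a := γ ^ (β₁ - β₂) * γ ^ (-β₁)) (by positivity)] at hb
  have h1 := (abs_le.1 hb).1
  have h2 : 0 < (κ₁ / 2 + κ₂ * γ ^ (β₁ - β₂)) * γ ^ (-β₁) := mul_pos (by linarith) hp
  have h3 : κ₁ / 2 * (γ ^ (β₁ - β₂) * γ ^ (-β₁)) ≤ κ₁ / 2 * γ ^ (-β₁) := by
    gcongr
    exact mul_le_of_le_one_left hp.le hle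
  nlinarith

/-- A sequence whose counting function is eventually nonzero near `0⁺` tends to zero. -/
theorem tendsto_zero_of_card_ne_zero {lam : ℕ → ℝ} (hpos : ∀ n, 0 < lam n) (hanti : Antitone lam)
    (hcard : ∀ᶠ γ in 𝓝[>] (0 : ℝ), (Nat.card {n : ℕ | γ ≤ lam n} : ℝ) ≠ 0) :
    Tendsto lam atTop (𝓝 0) := by
  rw [tendsto_order]
  refine ⟨fun a ha => .of_forall fun n => ha.trans (hpos n), fun a ha => ?_⟩
  obtain ⟨γ, hγ, hγa⟩ := (hcard.and (Ioo_mem_nhdsGT ha)).exists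
  have hfin : {n : ℕ | γ ≤ lam n}.Finite := by
    by_contra hinf
    exact hγ (by rw [Nat.card_coe_set_eq, Set.Infinite.ncard hinf, Nat.cast_zero])
  obtain ⟨m, hm⟩ := hfin.exists_notMem
  filter_upwards [eventually_ge_atTop m] with n hn
  exact (hanti hn).trans_lt ((not_le.1 hm).trans hγa.2)

/-- Evaluating the asymptotics of the counting function along the sequence itself. -/
theorem isLittleO_index_sub_of_counting_function {lam : ℕ → ℝ} (hpos : ∀ n, 0 < lam n)
    (hanti : Antitone lam) (hlim : Tendsto lam atTop (𝓝 0)) {κ₁ κ₂ β₁ β₂ : ℝ}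
    (hM : (fun γ : ℝ => (Nat.card {n : ℕ | γ ≤ lam n} : ℝ) - κ₁ * γ ^ (-β₁) - κ₂ * γ ^ (-β₂))
      =o[𝓝[>] 0] fun γ : ℝ => γ ^ (-β₂)) :
    (fun n : ℕ => ((n : ℝ) + 1) - κ₁ * lam n ^ (-β₁) - κ₂ * lam n ^ (-β₂))
      =o[atTop] fun n : ℕ => lam n ^ (-β₂) := by
  rw [isLittleO_iff]
  intro ε hε
  obtain ⟨δ, hδ, hb⟩ := mem_nhdsGT_iff_exists_Ioo_subset.1 (hM.bound hε)
  have hδ : 0 < δ := hδ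
  have hbound : ∀ γ, 0 < γ → γ < δ → |(Nat.card {n : ℕ | γ ≤ lam n} : ℝ)
      - κ₁ * γ ^ (-β₁) - κ₂ * γ ^ (-β₂)| ≤ ε * γ ^ (-β₂) := by
    intro γ h0 h1
    have := hb ⟨h0, h1⟩
    simpa only [Set.mem_ofPred_eq, Real.norm_eq_abs, abs_of_pos (Real.rpow_pos_of_pos h0 (-β₂))]
      using this
  filter_upwards [hlim.eventually_lt_const hδ] with n hn
  rw [Real.norm_eq_abs, Real.norm_eq_abs, abs_of_pos (Real.rpow_pos_of_pos (hpos n) _), abs_le]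
  have hupper : (n : ℝ) + 1 ≤ Nat.card {k : ℕ | lam n ≤ lam k} := by
    obtain ⟨m, hm⟩ := (hlim.eventually_lt_const (hpos n)).exists
    have hfin : {k : ℕ | lam n ≤ lam k}.Finite :=
      (Set.finite_lt_nat m).subset fun k hk => by
        by_contra hkm
        exact absurd (hk.trans (hanti (not_lt.1 hkm))) (not_le.2 hm)
    have := Set.ncard_le_ncard (s := (Finset.range (n + 1) : Set ℕ))
      (fun k hk => hanti (Nat.lt_succ_iff.1 (by simpa using hk))) hfin
    rw [Set.ncard_coe_finset, Finset.card_range] at this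
    rw [Nat.card_coe_set_eq]
    exact_mod_cast this
  have hlower : ∀ γ, lam n < γ → (Nat.card {k : ℕ | γ ≤ lam k} : ℝ) ≤ n := by
    intro γ hγ
    have := Set.ncard_le_ncard (s := {k : ℕ | γ ≤ lam k}) (t := (Finset.range n : Set ℕ))
      (fun k hk => by
        by_contra hkn
        have hnk : n ≤ k := by simpa using hkn
        exact absurd (hγ.trans_le (le_trans hk (hanti hnk))) (lt_irrefl _)) (Finset.finite_toSet _)
    rw [Set.ncard_coe_finset, Finset.card_range] at this
    rw [Nat.card_coe_set_eq]
    exact_mod_cast this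
  constructor
  · have hcont : Tendsto (fun γ : ℝ => κ₁ * γ ^ (-β₁) + κ₂ * γ ^ (-β₂) - ε * γ ^ (-β₂))
        (𝓝[>] lam n)
        (𝓝 (κ₁ * lam n ^ (-β₁) + κ₂ * lam n ^ (-β₂) - ε * lam n ^ (-β₂))) := by
      have hc (p : ℝ) : Tendsto (fun γ : ℝ => γ ^ p) (𝓝[>] lam n) (𝓝 (lam n ^ p)) :=
        (Real.continuousAt_rpow_const _ p (Or.inl (hpos n).ne')).tendsto.mono_left
          nhdsWithin_le_nhds
      exact (((hc _).const_mul _).add ((hc _).const_mul _)).sub ((hc _).const_mul _)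
    have hle := le_of_tendsto hcont (b := (n : ℝ)) (by
      filter_upwards [Ioo_mem_nhdsGT hn] with γ hγ
      have h1 := (abs_le.1 (hbound γ ((hpos n).trans hγ.1) hγ.2)).1
      have h2 := hlower γ hγ.1
      linarith)
    linarith
  · have := (abs_le.1 (hbound _ (hpos n) hn)).2
    linarith

/-- Inversion of the two-term expansion `x = κ₁ l^{-β₁} + κ₂ l^{-β₂} + o(l^{-β₂})`. -/
theorem isLittleO_rpow_expansion_inverse {ι : Type*} {f : Filter ι} {l x : ι → ℝ}
    (hl : ∀ i, 0 < l i) (hx : ∀ i, 0 < x i) (hlim : Tendsto l f (𝓝 0)) {κ₁ κ₂ β₁ β₂ : ℝ}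
    (hκ₁ : 0 < κ₁) (hβ₁ : 0 < β₁) (hβ : β₂ ≤ β₁) (hcase : β₁ = β₂ → κ₂ = 0)
    (h : (fun i => x i - κ₁ * l i ^ (-β₁) - κ₂ * l i ^ (-β₂)) =o[f] fun i => l i ^ (-β₂)) :
    (fun i => l i - κ₁ ^ (1 / β₁) * x i ^ (-(1 / β₁))
        - κ₁ ^ (1 / β₁ - β₂ / β₁) * κ₂ / β₁ * x i ^ (β₂ / β₁ - 1 / β₁ - 1))
      =o[f] fun i => x i ^ (β₂ / β₁ - 1 / β₁ - 1) := by
  set u : ι → ℝ := fun i => x i * l i ^ β₁ / κ₁ - 1 with hu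
  have hratio : Tendsto (fun i => u i / l i ^ (β₁ - β₂)) f (𝓝 (κ₂ / κ₁)) := by
    have h0 := (h.tendsto_div_nhds_zero.div_const κ₁).add_const (κ₂ / κ₁)
    rw [zero_div, zero_add] at h0
    refine h0.congr fun i => ?_
    have hp := Real.rpow_pos_of_pos (hl i) β₁
    have hq := Real.rpow_pos_of_pos (hl i) β₂
    rw [Real.rpow_sub (hl i), Real.rpow_neg (hl i).le, Real.rpow_neg (hl i).le]
    simp only [hu]
    field_simp
    ring
  have hu0 : Tendsto u f (𝓝 0) := by
    have hmul : Tendsto (fun i => u i / l i ^ (β₁ - β₂) * l i ^ (β₁ - β₂)) f (𝓝 0) := by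
      rcases hβ.eq_or_lt with he | hlt
      · simpa [he, hcase he.symm] using hratio
      · have h0 : 0 < β₁ - β₂ := sub_pos.2 hlt
        have hc := (Real.continuousAt_rpow_const (0 : ℝ) (β₁ - β₂) (Or.inr h0.le)).tendsto
        rw [Real.zero_rpow h0.ne'] at hc
        simpa using hratio.mul (hc.comp hlim)
    exact hmul.congr fun i => div_mul_cancel₀ _ (Real.rpow_pos_of_pos (hl i) _).ne'
  have hslope : Tendsto (fun i => dslope (fun t : ℝ => t ^ (1 / β₁)) 1 (1 + u i)) f
      (𝓝 (1 / β₁)) := by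
    have hd : HasDerivAt (fun t : ℝ => t ^ (1 / β₁)) (1 / β₁) 1 := by
      simpa using Real.hasDerivAt_rpow_const (x := 1) (p := 1 / β₁) (Or.inl one_ne_zero)
    have hc := (continuousAt_dslope_same.2 hd.differentiableAt).tendsto
    rw [dslope_same, hd.deriv] at hc
    exact hc.comp (by simpa using hu0.const_add 1)
  have hscale : Tendsto (fun i => l i ^ (β₁ - β₂) * x i ^ (1 - β₂ / β₁)) f
      (𝓝 (κ₁ ^ (1 - β₂ / β₁))) := by
    have hxl : Tendsto (fun i => x i * l i ^ β₁) f (𝓝 κ₁) := by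
      have h0 := (hu0.add_const 1).mul_const κ₁
      rw [zero_add, one_mul] at h0
      refine h0.congr fun i => ?_
      simp only [hu]
      field_simp
      ring
    refine ((Real.continuousAt_rpow_const κ₁ (1 - β₂ / β₁) (Or.inl hκ₁.ne')).tendsto.comp
      hxl).congr fun i => ?_
    simp only [Function.comp_apply]
    rw [Real.mul_rpow (hx i).le (Real.rpow_pos_of_pos (hl i) _).le, ← Real.rpow_mul (hl i).le,
      mul_comm]
    congr 2
    field_simp
  have hmain := (((hslope.mul hratio).mul hscale).const_mul (κ₁ ^ (1 / β₁))).sub_const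
    (κ₁ ^ (1 / β₁ - β₂ / β₁) * κ₂ / β₁)
  have hconst : κ₁ ^ (1 / β₁) * (1 / β₁ * (κ₂ / κ₁) * κ₁ ^ (1 - β₂ / β₁))
      - κ₁ ^ (1 / β₁ - β₂ / β₁) * κ₂ / β₁ = 0 := by
    rw [Real.rpow_sub hκ₁, Real.rpow_sub hκ₁, Real.rpow_one]
    field_simp
    ring
  rw [hconst] at hmain
  refine isLittleO_of_tendsto (fun i hi => absurd hi (Real.rpow_pos_of_pos (hx i) _).ne')
    (hmain.congr fun i => ?_)
  have hlpow := Real.rpow_pos_of_pos (hl i) (β₁ - β₂)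
  have hsl : dslope (fun t : ℝ => t ^ (1 / β₁)) 1 (1 + u i) * u i
      = (1 + u i) ^ (1 / β₁) - 1 := by
    have := sub_smul_dslope (fun t : ℝ => t ^ (1 / β₁)) 1 (1 + u i)
    simpa [mul_comm] using this
  have hroot : κ₁ ^ (1 / β₁) * (1 + u i) ^ (1 / β₁) = x i ^ (1 / β₁) * l i := by
    have h1 : 1 + u i = x i * l i ^ β₁ / κ₁ := by simp [hu]
    have hlp := Real.rpow_pos_of_pos (hl i) β₁
    rw [← Real.mul_rpow hκ₁.le (by rw [h1]; exact (div_pos (mul_pos (hx i) hlp) hκ₁).le), h1,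
      mul_div_cancel₀ _ hκ₁.ne', Real.mul_rpow (hx i).le hlp.le, ← Real.rpow_mul (hl i).le,
      mul_one_div_cancel hβ₁.ne', Real.rpow_one]
  have hxa := Real.rpow_pos_of_pos (hx i) (1 / β₁)
  have hxb := Real.rpow_pos_of_pos (hx i) (β₂ / β₁)
  have hxi := hx i
  calc κ₁ ^ (1 / β₁) * (dslope (fun t : ℝ => t ^ (1 / β₁)) 1 (1 + u i)
          * (u i / l i ^ (β₁ - β₂)) * (l i ^ (β₁ - β₂) * x i ^ (1 - β₂ / β₁)))
        - κ₁ ^ (1 / β₁ - β₂ / β₁) * κ₂ / β₁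
      = κ₁ ^ (1 / β₁) * (dslope (fun t : ℝ => t ^ (1 / β₁)) 1 (1 + u i) * u i)
          * x i ^ (1 - β₂ / β₁) - κ₁ ^ (1 / β₁ - β₂ / β₁) * κ₂ / β₁ := by
        field_simp
    _ = (x i ^ (1 / β₁) * l i - κ₁ ^ (1 / β₁)) * x i ^ (1 - β₂ / β₁)
          - κ₁ ^ (1 / β₁ - β₂ / β₁) * κ₂ / β₁ := by
        rw [hsl, mul_sub, hroot, mul_one]
    _ = _ := by
        generalize κ₁ ^ (1 / β₁ - β₂ / β₁) * κ₂ / β₁ = B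
        generalize κ₁ ^ (1 / β₁) = A
        rw [Real.rpow_sub hxi, Real.rpow_sub hxi, Real.rpow_sub hxi, Real.rpow_neg hxi.le,
          Real.rpow_one]
        generalize x i ^ (1 / β₁) = a at *
        generalize x i ^ (β₂ / β₁) = b at *
        field_simp

theorem eigenvalue_asymptotics_of_counting_function
    {H : Type*} [NormedAddCommGroup H] [InnerProductSpace ℝ H] [CompleteSpace H]
    [SeparableSpace H]
    (T : H →L[ℝ] H) (hcomp : IsCompactOperator T) (hposop : T.IsPositive)
    -- `ψ` is an orthonormal basis of `H` consisting of eigenvectors of `T`,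
    -- with eigenvalues `lam n` (here `lam n` is the eigenvalue `λ_{n+1}`),
    -- arranged in non-increasing order and counted with multiplicity
    (ψ : ℕ → H) (hON : Orthonormal ℝ ψ)
    (hdense : (Submodule.span ℝ (Set.range ψ)).topologicalClosure = ⊤)
    (lam : ℕ → ℝ) (heig : ∀ n, T (ψ n) = lam n • ψ n)
    (hlampos : ∀ n, 0 < lam n) (hanti : Antitone lam)
    (κ₁ κ₂ β₁ β₂ : ℝ) (hκ₁ : 0 < κ₁) (hβ₂ : 0 < β₂) (hβ : β₂ ≤ β₁)
    (hcase : β₁ = β₂ → κ₂ = 0)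
    -- the eigenvalue-counting function `M_T(γ) = #{n : λ_n ≥ γ}` satisfies
    -- `M_T(γ) = κ₁ γ^{-β₁} + κ₂ γ^{-β₂} + o(γ^{-β₂})` as `γ → 0`
    (hasymp : (fun γ : ℝ => (Nat.card {n : ℕ | γ ≤ lam n} : ℝ)
        - κ₁ * γ ^ (-β₁) - κ₂ * γ ^ (-β₂))
      =o[𝓝[>] 0] fun γ : ℝ => γ ^ (-β₂)) :
    (fun n : ℕ => lam n - κ₁ ^ (1 / β₁) * ((n : ℝ) + 1) ^ (-(1 / β₁))
        - κ₁ ^ (1 / β₁ - β₂ / β₁) * κ₂ / β₁ * ((n : ℝ) + 1) ^ (β₂ / β₁ - 1 / β₁ - 1))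
      =o[atTop] fun n : ℕ => ((n : ℝ) + 1) ^ (β₂ / β₁ - 1 / β₁ - 1) := by
  have hlim : Tendsto lam atTop (𝓝 0) := tendsto_zero_of_card_ne_zero hlampos hanti
    (eventually_ne_zero_of_isLittleO_rpow hκ₁ hβ hcase hasymp)
  exact isLittleO_rpow_expansion_inverse hlampos (fun n => by positivity) hlim hκ₁
    (hβ₂.trans_le hβ) hβ hcase
    (isLittleO_index_sub_of_counting_function hlampos hanti hlim hasymp)
end
end
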